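/- There exists an absolute constant C > 0 such that for every odd prime p, every Dirichlet character χ modulo p with χ² ≠ χ₀ (where χ₀ is the principal character modulo p), and every real x ≥ 2, one has | ∑_{m ≤ x, m square-full} χ(m) | ≤ C · x^{1/3} · p^{1/9} · (log p)^{1/6} · (log x). -/

import Mathlib

/-- A positive integer `n` is square-full if every prime `q` dividing `n` satisfies `q^2 ∣ n`. -/
def Squarefull (n : ℕ) : Prop := ∀ q : ℕ, q.Prime → q ∣ n → q ^ 2 ∣ n

section

open Polynomial

/-- Terms with pairwise distinct orders of vanishing at a point are linearly independent. -/
theorem sum_C_mul_X_sub_C_pow_mul_ne_zero {F ι : Type*} [Field F] [Fintype ι] (c : F) {e : ι → ℕ}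
    (he : Function.Injective e) {u : ι → F[X]} (hu : ∀ i, (u i).eval c ≠ 0) {t : ι → F}
    (ht : ∃ i, t i ≠ 0) : ∑ i, C (t i) * ((X - C c) ^ e i * u i) ≠ 0 := by
  classical
  intro h0
  obtain ⟨i₀, hi₀, hmin⟩ := Finset.exists_min_image (Finset.univ.filter fun i => t i ≠ 0) e
    (by obtain ⟨i, hi⟩ := ht; exact ⟨i, by simpa using hi⟩)
  have hti : t i₀ ≠ 0 := by simpa using hi₀
  have hdvd : (X - C c) ^ (e i₀ + 1) ∣
      ∑ i ∈ Finset.univ.erase i₀, C (t i) * ((X - C c) ^ e i * u i) := by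
    refine Finset.dvd_sum fun i hi => ?_
    by_cases hz : t i = 0
    · simp [hz]
    · have h1 : e i₀ ≤ e i := hmin i (by simpa using hz)
      have h2 : e i₀ ≠ e i := fun h => (Finset.ne_of_mem_erase hi) (he h).symm
      exact ((pow_dvd_pow _ (by omega)).mul_right _).mul_left _
  rw [← Finset.add_sum_erase _ _ (Finset.mem_univ i₀)] at h0
  have h3 : (X - C c) ^ (e i₀ + 1) ∣ C (t i₀) * ((X - C c) ^ e i₀ * u i₀) :=
    (dvd_add_left hdvd).1 (h0 ▸ dvd_zero _)
  rw [pow_succ, show C (t i₀) * ((X - C c) ^ e i₀ * u i₀) = (X - C c) ^ e i₀ * (C (t i₀) * u i₀)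
    by ring] at h3
  have h4 := (mul_dvd_mul_iff_left (pow_ne_zero _ (X_sub_C_ne_zero c))).1 h3
  rw [dvd_iff_isRoot, IsRoot.def, eval_mul, eval_C] at h4
  exact mul_ne_zero hti (hu i₀) h4

/-- Too many elements of a space of polynomials of bounded degree are linearly dependent. -/
theorem exists_linear_relation_of_natDegree_lt {F ι : Type*} [Field F] [Fintype ι]
    (v : ι → Polynomial F) {R : ℕ} (hv : ∀ i, (v i).natDegree < R) (hR : R < Fintype.card ι) :
    ∃ s : ι → F, ∑ i, Polynomial.C (s i) * v i = 0 ∧ ∃ i, s i ≠ 0 := by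
  let w : ι → Polynomial.degreeLT F R := fun i => ⟨v i, by
    rw [Polynomial.mem_degreeLT]
    exact (Polynomial.degree_le_natDegree).trans_lt (by exact_mod_cast hv i)⟩
  have hw : ¬ LinearIndependent F w := by
    intro h
    have h1 := h.fintype_card_le_finrank
    rw [(Polynomial.degreeLTEquiv F R).finrank_eq, Module.finrank_fin_fun] at h1
    omega
  obtain ⟨s, hs, i, hi⟩ := Fintype.not_linearIndependent_iff.1 hw
  refine ⟨s, ?_, i, hi⟩
  have := congrArg Subtype.val hs
  simpa [w, Polynomial.smul_eq_C_mul] using this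

theorem mixedRadix_injective {d κ M P : ℕ} (hP : P = d * M + 1) :
    Function.Injective fun x : Fin d × Fin κ × Fin M =>
      (x.2.2 : ℕ) + x.1 * M + x.2.1 * P := by
  rintro ⟨j, k, i⟩ ⟨j', k', i'⟩ h
  simp only at h
  have hb (j : Fin d) (i : Fin M) : (i : ℕ) + j * M < P := by
    have : (j + 1 : ℕ) * M ≤ d * M := Nat.mul_le_mul_right _ j.2
    have := i.2
    rw [add_mul] at *
    omega
  have hP0 : 0 < P := by omega
  have h1 : (k : ℕ) = k' := by
    have := congrArg (· / P) h
    simpa [Nat.add_mul_div_right _ _ hP0, Nat.div_eq_of_lt (hb _ _)] using this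
  rw [h1] at h
  have h2 : (i : ℕ) + j * M = i' + j' * M := by omega
  have hM0 : 0 < M := i.pos
  have h3 : (j : ℕ) = j' := by
    have := congrArg (· / M) h2
    simpa [Nat.add_mul_div_right _ _ hM0, Nat.div_eq_of_lt i.2, Nat.div_eq_of_lt i'.2] using this
  rw [h3] at h2
  ext <;> simp <;> omega

/-- Stepanov's bound, in Bombieri's form: over a field with `P ^ 2` elements, where
`P = d * M + 1`, the polynomial `f` with a simple root at `c` takes values in any prescribed coset
of the `d`-th powers about as often as expected. -/
theorem card_pow_eq_le {F : Type*} [Field F] [Fintype F] [DecidableEq F] {p μ P d M D : ℕ}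
    [Fact p.Prime] [CharP F p] (hPp : P = p ^ μ) (hcard : Fintype.card F = P ^ 2)
    (hP : P = d * M + 1) (hD : 2 * D + 5 ≤ P) (hd : 0 < d)
    {f f₁ : F[X]} {c : F} (hf : f = (X - C c) * f₁) (hf₁ : f₁.eval c ≠ 0)
    (hdeg : f.natDegree ≤ D) (a : F) :
    (Finset.univ.filter fun x : F => f.eval x ^ (M * (P + 1)) = a).card ≤
      M * P + (2 * D + 4) * P := by
  set κ := M + D + 3 with hκ
  have hT (n : ℕ) : ((X - C c) ^ n).natDegree = n := by simp
  have hMP : M ≤ P := by nlinarith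
  have hjM (j : Fin d) : (j : ℕ) * M ≤ d * M := Nat.mul_le_mul_right _ j.2.le
  let v : Fin d × Fin κ × Fin M → F[X] := fun x =>
    (X - C c) ^ ((x.2.2 : ℕ) * P + x.2.1) * (C (a ^ (x.1 : ℕ)) * f ^ (P - x.1 * M))
  have hv (x) : (v x).natDegree < (M + D) * P + κ := by
    obtain ⟨j, k, i⟩ := x
    have h1 : (v (j, k, i)).natDegree ≤ (i * P + k) + (0 + P * D) := by
      refine natDegree_mul_le.trans (add_le_add (hT _).le (natDegree_mul_le.trans
        (add_le_add (natDegree_C _).le (natDegree_pow_le.trans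
          (Nat.mul_le_mul (Nat.sub_le _ _) hdeg)))))
    have h2 : (i + 1 : ℕ) * P ≤ M * P := Nat.mul_le_mul_right _ i.2
    have := k.2
    nlinarith
  obtain ⟨s, hs, i₀, hi₀⟩ := exists_linear_relation_of_natDegree_lt v hv (by
    simp only [Fintype.card_prod, Fintype.card_fin]
    obtain ⟨y, hy⟩ : ∃ y, P = y + 5 + 2 * D := ⟨P - 5 - 2 * D, by omega⟩
    have : d * (κ * M) = κ * (P - 1) := by rw [hP]; simp; ring
    rw [this, hκ]
    have h1 : P - 1 = P - 2 + 1 := by omega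
    have h2 : P = P - 2 + 2 := by omega
    generalize P - 2 = z at *
    nlinarith)
  have hfrob : Function.Surjective fun t : F => t ^ P := by
    have := (bijective_iterateFrobenius F p μ).surjective
    intro y
    obtain ⟨x, hx⟩ := this y
    exact ⟨x, by simpa [iterateFrobenius_def, hPp] using hx⟩
  have hP0 : P ≠ 0 := by omega
  choose t ht using fun i => hfrob (s i)
  simp only at ht
  let V : F[X] := ∑ x : Fin d × Fin κ × Fin M,
    C (t x) * ((X - C c) ^ ((x.2.2 : ℕ) + x.1 * M + x.2.1 * P) * f₁ ^ ((x.1 : ℕ) * M))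
  have hV : V ≠ 0 := sum_C_mul_X_sub_C_pow_mul_ne_zero c (mixedRadix_injective hP)
    (fun i => by rw [eval_pow]; exact pow_ne_zero _ hf₁)
    ⟨i₀, fun h => hi₀ (by rw [← ht, h, zero_pow hP0])⟩
  have hV' : V = ∑ x : Fin d × Fin κ × Fin M,
      C (t x) * ((X - C c) ^ ((x.2.2 : ℕ) + x.2.1 * P) * f ^ ((x.1 : ℕ) * M)) := by
    refine Finset.sum_congr rfl fun x _ => ?_
    rw [hf, mul_pow]; ring
  have hf0 : f ≠ 0 := by
    rw [hf]
    exact mul_ne_zero (X_sub_C_ne_zero c) (fun h => hf₁ (by simp [h]))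
  have hfV : f * V ≠ 0 := mul_ne_zero hf0 hV
  have hdegV : (f * V).natDegree ≤ M * P + (2 * D + 4) * P := by
    have h1 : V.natDegree ≤ M + (M + D + 2) * P + P * D := by
      rw [hV']
      refine natDegree_sum_le_of_forall_le _ _ fun x _ => ?_
      obtain ⟨j, k, i⟩ := x
      refine (natDegree_C_mul_le _ _).trans (natDegree_mul_le.trans (add_le_add ?_ ?_))
      · rw [hT]
        have := i.2
        have : (k : ℕ) * P ≤ (M + D + 2) * P := Nat.mul_le_mul_right _ (by have := k.2; omega)
        simp only
        omega
      · refine natDegree_pow_le.trans (Nat.mul_le_mul ?_ hdeg)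
        have := hjM j
        simp only
        omega
    refine natDegree_mul_le.trans ((add_le_add hdeg h1).trans ?_)
    nlinarith
  refine le_trans (Finset.card_le_card (t := (f * V).roots.toFinset) ?_)
    ((Multiset.toFinset_card_le _).trans ((card_roots' _).trans hdegV))
  intro x hx
  simp only [Finset.mem_filter, Finset.mem_univ, true_and] at hx
  rw [Multiset.mem_toFinset, mem_roots hfV, IsRoot.def]
  refine eq_zero_of_pow_eq_zero (n := P) ?_
  have hQ (y : F) : y ^ (P * P) = y := by
    rw [← pow_two, ← hcard, FiniteField.pow_card]
  have hs' := congrArg (eval x) hs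
  rw [eval_zero, eval_finsetSum] at hs'
  rw [← hs', hV', eval_mul, eval_finsetSum, Finset.mul_sum]
  have : ExpChar F p := ExpChar.prime Fact.out
  conv_lhs => rw [hPp]
  rw [sum_pow_char_pow, ← hPp]
  refine Finset.sum_congr rfl fun y _ => ?_
  obtain ⟨j, k, i⟩ := y
  have hjP : (j : ℕ) * M ≤ P := (hjM j).trans (by omega)
  simp only [v, eval_mul, eval_pow, eval_C, eval_sub, eval_X, ← ht, ← hx]
  have h1 : (f.eval x * (t (j, k, i) * ((x - c) ^ ((i : ℕ) + k * P) * f.eval x ^ ((j : ℕ) * M)))) ^ P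
    = t (j, k, i) ^ P * ((x - c) ^ ((i : ℕ) * P) * ((x - c) ^ (P * P)) ^ (k : ℕ)) *
      (f.eval x ^ P * f.eval x ^ ((j : ℕ) * M * P)) := by ring
  rw [h1, hQ, pow_add, mul_assoc, ← pow_mul (f.eval x)]
  congr 2
  rw [← pow_add, ← pow_add]
  congr 1
  have : M * (P + 1) * j = j * M * P + j * M := by ring
  omega

theorem norm_algebraMap_sub {K L : Type*} [Field K] [Field L] [Algebra K L] [FiniteDimensional K L]
    (c : K) (x : L) : Algebra.norm K (algebraMap K L c - x) =
      (minpoly K x).eval c ^ (Module.finrank K L / (minpoly K x).natDegree) := by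
  set y := x - algebraMap K L c with hy
  have hint : IsIntegral K y := IsIntegral.of_finite K y
  have hmin : minpoly K y = (minpoly K x).comp (X + C c) := minpoly.sub_algebraMap x c
  have hdeg : (minpoly K y).natDegree = (minpoly K x).natDegree := by
    rw [hmin, natDegree_comp, natDegree_X_add_C, mul_one]
  have hfin : (minpoly K x).natDegree * Module.finrank (IntermediateField.adjoin K {y}) L =
      Module.finrank K L := by
    rw [← hdeg, ← IntermediateField.adjoin.finrank hint]
    exact Module.finrank_mul_finrank _ _ _
  have hpos : 0 < (minpoly K x).natDegree := minpoly.natDegree_pos (IsIntegral.of_finite K x)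
  have h1 : Algebra.norm K (IntermediateField.AdjoinSimple.gen K y) =
      (-1) ^ (minpoly K x).natDegree * (minpoly K x).eval c := by
    rw [← IntermediateField.adjoin.powerBasis_gen hint,
      Algebra.PowerBasis.norm_gen_eq_coeff_zero_minpoly, IntermediateField.adjoin.powerBasis_dim,
      IntermediateField.adjoin.powerBasis_gen, IntermediateField.minpoly_gen, hdeg, hmin,
      coeff_zero_eq_eval_zero, eval_comp]
    simp
  have h2 : algebraMap K L c - x = algebraMap K L (-1) * y := by simp [hy]
  rw [h2, map_mul, Algebra.norm_algebraMap, Algebra.norm_eq_norm_adjoin, h1, mul_pow, ← pow_mul,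
    hfin, ← mul_assoc, ← mul_pow, neg_one_mul, neg_neg, one_pow, one_mul,
    ← hfin, Nat.mul_div_cancel_left _ hpos]

noncomputable instance (p n : ℕ) [Fact p.Prime] : Fintype (GaloisField p n) := Fintype.ofFinite _

theorem natDegree_minpoly_dvd {p k : ℕ} [Fact p.Prime] (hk : k ≠ 0) (x : GaloisField p k) :
    (minpoly (ZMod p) x).natDegree ∣ k := by
  have := minpoly.degree_dvd (IsIntegral.of_finite (ZMod p) x)
  rwa [GaloisField.finrank p hk] at this

open scoped Classical in
theorem card_minpoly_eq {p k : ℕ} [Fact p.Prime] (hk : k ≠ 0) {P : (ZMod p)[X]}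
    (hP : Irreducible P) (hPm : P.Monic) :
    (Finset.univ.filter fun x : GaloisField p k => minpoly (ZMod p) x = P).card =
      if P.natDegree ∣ k then P.natDegree else 0 := by
  split_ifs with h
  · have hdvd := (hP.natDegree_dvd_iff_dvd_X_pow_card_pow_sub_X).1 h
    have hsplit : (P.map (algebraMap (ZMod p) (GaloisField p k))).Splits := by
      have h1 := FiniteField.splits_X_pow_nat_card_sub_X p (K := GaloisField p k)
      rw [GaloisField.card p k hk] at h1
      rw [Nat.card_zmod] at hdvd
      refine h1.of_dvd ?_ (Polynomial.map_dvd _ hdvd)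
      exact (Polynomial.map_ne_zero_iff (algebraMap (ZMod p) (GaloisField p k)).injective).2
        (FiniteField.X_pow_card_pow_sub_X_ne_zero _ hk (Fact.out : p.Prime).one_lt)
    have hsep : (P.map (algebraMap (ZMod p) (GaloisField p k))).Separable :=
      (PerfectField.separable_of_irreducible hP).map
    rw [← Polynomial.natDegree_map (algebraMap (ZMod p) (GaloisField p k)),
      hsplit.natDegree_eq_card_roots, ← Multiset.toFinset_card_of_nodup (nodup_roots hsep)]
    congr 1
    ext x
    have hne : P.map (algebraMap (ZMod p) (GaloisField p k)) ≠ 0 := (hPm.map _).ne_zero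
    simp only [Finset.mem_filter, Finset.mem_univ, true_and, Multiset.mem_toFinset,
      mem_roots hne, IsRoot.def, eval_map_algebraMap]
    exact ⟨fun hx => hx ▸ minpoly.aeval _ _,
      fun hx => (minpoly.eq_of_irreducible_of_monic hP hx hPm).symm⟩
  · rw [Finset.card_eq_zero, Finset.filter_eq_empty_iff]
    intro x _ hx
    apply h
    exact hx ▸ natDegree_minpoly_dvd hk x

/-- The characteristic polynomial over the prime field of an element of the field with `p ^ k`
elements. -/
noncomputable def frobeniusCharpoly {p k : ℕ} [Fact p.Prime] (x : GaloisField p k) : (ZMod p)[X] :=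
  minpoly (ZMod p) x ^ (k / (minpoly (ZMod p) x).natDegree)

theorem frobeniusCharpoly_monic {p k : ℕ} [Fact p.Prime] (x : GaloisField p k) :
    (frobeniusCharpoly x).Monic :=
  (minpoly.monic (IsIntegral.of_finite _ x)).pow _

theorem natDegree_frobeniusCharpoly {p k : ℕ} [Fact p.Prime] (hk : k ≠ 0) (x : GaloisField p k) :
    (frobeniusCharpoly x).natDegree = k := by
  rw [frobeniusCharpoly, natDegree_pow, Nat.div_mul_cancel (natDegree_minpoly_dvd hk x)]

open scoped Classical in
open UniqueFactorizationMonoid in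
/-- The additive form of `∑_{h ∣ g} Λ(h) = deg g` for polynomials over a finite field. -/
theorem sum_card_frobeniusCharpoly_dvd {p : ℕ} [Fact p.Prime] {g : (ZMod p)[X]} (hg : g.Monic) :
    ∑ k ∈ Finset.Icc 1 g.natDegree,
      (Finset.univ.filter fun x : GaloisField p k => frobeniusCharpoly x ∣ g).card =
      g.natDegree := by
  have hg0 : g ≠ 0 := hg.ne_zero
  have hmem {P} (hP : P ∈ normalizedFactors g) : Irreducible P ∧ P.Monic :=
    ⟨irreducible_of_normalized_factor P hP, by
      rw [← normalize_normalized_factor P hP]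
      exact monic_normalize (irreducible_of_normalized_factor P hP).ne_zero⟩
  have hpow {P} (hP : P ∈ normalizedFactors g) (n : ℕ) :
      P ^ n ∣ g ↔ n ≤ (normalizedFactors g).count P := by
    rw [pow_dvd_iff_le_emultiplicity,
      emultiplicity_eq_count_normalizedFactors (hmem hP).1 hg0,
      normalize_normalized_factor P hP, Nat.cast_le]
  have hfib (k) (hk : k ∈ Finset.Icc 1 g.natDegree) :
      (Finset.univ.filter fun x : GaloisField p k => frobeniusCharpoly x ∣ g).card =
      ∑ P ∈ (normalizedFactors g).toFinset,
        if P.natDegree ∣ k ∧ k / P.natDegree ≤ (normalizedFactors g).count P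
          then P.natDegree else 0 := by
    have hk1 : 1 ≤ k := (Finset.mem_Icc.1 hk).1
    rw [Finset.card_eq_sum_card_fiberwise (f := fun x => minpoly (ZMod p) x)
      (t := (normalizedFactors g).toFinset)]
    · refine Finset.sum_congr rfl fun P hP => ?_
      rw [Multiset.mem_toFinset] at hP
      rw [Finset.filter_filter]
      have : (Finset.univ.filter fun x : GaloisField p k =>
          frobeniusCharpoly x ∣ g ∧ minpoly (ZMod p) x = P) =
          if k / P.natDegree ≤ (normalizedFactors g).count P then
            Finset.univ.filter fun x : GaloisField p k => minpoly (ZMod p) x = P else ∅ := by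
        split_ifs with h
        · refine Finset.filter_congr fun x _ => ⟨fun h => h.2, fun hx => ⟨?_, hx⟩⟩
          rwa [frobeniusCharpoly, hx, hpow hP]
        · rw [Finset.filter_eq_empty_iff]
          rintro x - ⟨hx, hx'⟩
          rw [frobeniusCharpoly, hx', hpow hP] at hx
          exact h hx
      rw [this]
      by_cases h : k / P.natDegree ≤ (normalizedFactors g).count P
      · simp [h, card_minpoly_eq (by omega : k ≠ 0) (hmem hP).1 (hmem hP).2]
      · simp [h]
    · intro x hx
      simp only [Finset.coe_filter, Finset.mem_univ, true_and, Set.mem_ofPred_eq] at hx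
      have hirr := minpoly.irreducible (IsIntegral.of_finite (ZMod p) x)
      have hmon := minpoly.monic (IsIntegral.of_finite (ZMod p) x)
      have hpos : k / (minpoly (ZMod p) x).natDegree ≠ 0 :=
        (Nat.div_pos (Nat.le_of_dvd hk1 (natDegree_minpoly_dvd (by omega) x))
          hirr.natDegree_pos).ne'
      obtain ⟨q, hq, hassoc⟩ := exists_mem_normalizedFactors_of_dvd hg0 hirr
        ((dvd_pow_self _ hpos).trans hx)
      simp only [SetLike.mem_coe, Multiset.mem_toFinset]
      rwa [eq_of_monic_of_associated hmon (hmem hq).2 hassoc]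
  rw [Finset.sum_congr rfl hfib, Finset.sum_comm]
  have hsum (P) (hP : P ∈ (normalizedFactors g).toFinset) :
      (∑ k ∈ Finset.Icc 1 g.natDegree,
        if P.natDegree ∣ k ∧ k / P.natDegree ≤ (normalizedFactors g).count P
          then P.natDegree else 0) = (normalizedFactors g).count P * P.natDegree := by
    rw [Multiset.mem_toFinset] at hP
    have hpos : 0 < P.natDegree := (hmem hP).1.natDegree_pos
    rw [← Finset.sum_filter, Finset.sum_const, smul_eq_mul]
    congr 1
    trans ((Finset.Icc 1 ((normalizedFactors g).count P)).image (P.natDegree * ·)).card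
    · congr 1
      ext k
      simp only [Finset.mem_filter, Finset.mem_Icc, Finset.mem_image]
      constructor
      · rintro ⟨⟨h1, h2⟩, ⟨j, rfl⟩, h4⟩
        rw [Nat.mul_div_cancel_left _ hpos] at h4
        exact ⟨j, ⟨Nat.pos_of_mul_pos_left h1, h4⟩, rfl⟩
      · rintro ⟨j, ⟨h1, h2⟩, rfl⟩
        rw [Nat.mul_div_cancel_left _ hpos]
        refine ⟨⟨Nat.mul_pos hpos h1, ?_⟩, dvd_mul_right _ _, h2⟩
        have := natDegree_le_of_dvd ((hpow hP j).2 h2) hg0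
        rwa [natDegree_pow, mul_comm] at this
    · rw [Finset.card_image_of_injective _ (fun a b h => Nat.eq_of_mul_eq_mul_left hpos h)]
      simp
  rw [Finset.sum_congr rfl hsum]
  have hprod := prod_normalizedFactors_eq hg0
  rw [hg.normalize_eq_self] at hprod
  conv_rhs => rw [← hprod, natDegree_multiset_prod_of_monic _ fun P hP => (hmem hP).2]
  rw [Finset.sum_multiset_map_count]
  simp

theorem finite_monic_natDegree_eq (p n : ℕ) [Fact p.Prime] :
    {g : (ZMod p)[X] | g.Monic ∧ g.natDegree = n}.Finite := by
  have : Finite (degreeLT (ZMod p) (n + 1)) :=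
    Finite.of_equiv _ (degreeLTEquiv (ZMod p) (n + 1)).toEquiv.symm
  refine (Set.toFinite (degreeLT (ZMod p) (n + 1) : Set (ZMod p)[X])).subset ?_
  rintro g ⟨-, hg⟩
  rw [SetLike.mem_coe, mem_degreeLT]
  exact degree_le_natDegree.trans_lt (by rw [hg]; exact_mod_cast n.lt_succ_self)

/-- The finite set of monic polynomials of degree `n` over the field with `p` elements. -/
noncomputable def monicsOfDegree (p n : ℕ) [Fact p.Prime] : Finset (ZMod p)[X] :=
  (finite_monic_natDegree_eq p n).toFinset

@[simp]
theorem mem_monicsOfDegree {p n : ℕ} [Fact p.Prime] {g : (ZMod p)[X]} :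
    g ∈ monicsOfDegree p n ↔ g.Monic ∧ g.natDegree = n := by
  simp [monicsOfDegree]

/-- The `n`-th coefficient of the `L`-function of a multiplicative function on polynomials. -/
noncomputable def lCoeff {p : ℕ} [Fact p.Prime] (ψ : (ZMod p)[X] →* ℂ) (n : ℕ) : ℂ :=
  ∑ g ∈ monicsOfDegree p n, ψ g

/-- The complete sum attached to `ψ` over the field with `p ^ k` elements. -/
noncomputable def extSum {p : ℕ} [Fact p.Prime] (ψ : (ZMod p)[X] →* ℂ) (k : ℕ) : ℂ :=
  ∑ x : GaloisField p k, ψ (frobeniusCharpoly x)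

theorem lCoeff_zero {p : ℕ} [Fact p.Prime] (ψ : (ZMod p)[X] →* ℂ) : lCoeff ψ 0 = 1 := by
  have : monicsOfDegree p 0 = {1} := by
    ext g
    simp only [mem_monicsOfDegree, Finset.mem_singleton]
    exact ⟨fun h => (h.1.natDegree_eq_zero).1 h.2, by rintro rfl; simp⟩
  simp [lCoeff, this]

open scoped Classical in
/-- The logarithmic derivative of the `L`-function. -/
theorem natCast_mul_lCoeff {p : ℕ} [Fact p.Prime] (ψ : (ZMod p)[X] →* ℂ) (n : ℕ) :
    (n : ℂ) * lCoeff ψ n = ∑ k ∈ Finset.Icc 1 n, extSum ψ k * lCoeff ψ (n - k) := by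
  have h1 (k) (hk : k ∈ Finset.Icc 1 n) : extSum ψ k * lCoeff ψ (n - k) =
      ∑ g ∈ monicsOfDegree p n, ∑ x : GaloisField p k,
        if frobeniusCharpoly x ∣ g then ψ g else 0 := by
    rw [Finset.mem_Icc] at hk
    rw [extSum, Finset.sum_mul, Finset.sum_comm]
    refine Finset.sum_congr rfl fun x _ => ?_
    have hm := frobeniusCharpoly_monic x
    have hd := natDegree_frobeniusCharpoly (by omega) x
    rw [lCoeff, Finset.mul_sum, ← Finset.sum_filter]
    refine Finset.sum_bij (fun g _ => frobeniusCharpoly x * g) ?_ ?_ ?_ ?_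
    · intro g hg
      rw [mem_monicsOfDegree] at hg
      simp only [Finset.mem_filter, mem_monicsOfDegree, dvd_mul_right, and_true]
      exact ⟨hm.mul hg.1, by rw [hm.natDegree_mul hg.1, hd, hg.2]; omega⟩
    · intro g _ g' _ h
      exact mul_left_cancel₀ hm.ne_zero h
    · intro g hg
      simp only [Finset.mem_filter, mem_monicsOfDegree] at hg
      obtain ⟨⟨hg1, hg2⟩, q, rfl⟩ := hg
      have hq := hm.of_mul_monic_left hg1
      refine ⟨q, ?_, rfl⟩
      rw [hm.natDegree_mul hq, hd] at hg2
      exact mem_monicsOfDegree.2 ⟨hq, by omega⟩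
    · intro g _
      rw [map_mul]
  rw [Finset.sum_congr rfl h1, Finset.sum_comm, lCoeff, Finset.mul_sum]
  refine Finset.sum_congr rfl fun g hg => ?_
  rw [mem_monicsOfDegree] at hg
  have h2 := sum_card_frobeniusCharpoly_dvd hg.1
  rw [hg.2] at h2
  conv_lhs => rw [← h2]
  simp only [← Finset.sum_filter, Finset.sum_const, nsmul_eq_mul, ← Finset.sum_mul, Nat.cast_sum]

/-- A sequence `S` related by Newton's identities to the coefficients of a polynomial is, up to
sign, the sequence of power sums of its inverse roots. -/
theorem exists_eq_neg_sum_pow {c S : ℕ → ℂ} {r : ℕ} (h0 : c 0 = 1) (hr : ∀ n, r < n → c n = 0)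
    (hrec : ∀ n : ℕ, (n : ℂ) * c n = ∑ k ∈ Finset.Icc 1 n, S k * c (n - k)) :
    ∃ α : Fin r → ℂ, ∀ n, 1 ≤ n → S n = -∑ i, α i ^ n := by
  let Q : ℂ[X] := ∑ i ∈ Finset.range (r + 1), C (c i) * X ^ (r - i)
  have hcoeff (i : ℕ) (hi : i ≤ r) : Q.coeff (r - i) = c i := by
    simp only [Q, finsetSum_coeff, coeff_C_mul_X_pow]
    rw [Finset.sum_eq_single i]
    · simp
    · intro j hj hji
      rw [Finset.mem_range] at hj
      rw [if_neg (by omega)]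
    · intro h; simp only [Finset.mem_range] at h; omega
  have hdeg : Q.natDegree ≤ r := by
    refine natDegree_sum_le_of_forall_le _ _ fun i _ => (natDegree_C_mul_X_pow_le _ _).trans ?_
    omega
  have hmon : Q.Monic := monic_of_natDegree_le_of_coeff_eq_one r hdeg (by
    have := hcoeff 0 (by omega); rwa [h0, Nat.sub_zero] at this)
  have hdeg' : Q.natDegree = r := by
    refine le_antisymm hdeg (le_natDegree_of_ne_zero ?_)
    have := hcoeff 0 (by omega)
    rw [Nat.sub_zero, h0] at this
    simp [this]
  have hcard : Q.roots.card = r := by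
    rw [← (IsAlgClosed.splits Q).natDegree_eq_card_roots, hdeg']
  obtain ⟨α, hα⟩ : ∃ α : Fin r → ℂ, Q.roots = Finset.univ.val.map α := by
    refine ⟨fun i => Q.roots.toList.get (i.cast (by simp [hcard])), ?_⟩
    conv_lhs => rw [← Multiset.coe_toList Q.roots]
    rw [Fin.univ_val_map]
    congr 1
    refine List.ext_get (by simp [hcard]) fun n h1 h2 => ?_
    simp
  have hesymm (i : ℕ) : c i = (-1) ^ i * MvPolynomial.aeval α (MvPolynomial.esymm (Fin r) ℂ i) := by
    rw [MvPolynomial.aeval_esymm_eq_multiset_esymm, ← hα]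
    rcases le_or_gt i r with hi | hi
    · rw [← hcoeff i hi, coeff_eq_esymm_roots_of_card (by rw [hcard, hdeg']) (by omega),
        hmon.leadingCoeff, hdeg', one_mul, Nat.sub_sub_self hi]
    · rw [hr i hi, Multiset.esymm, Multiset.powersetCard_eq_empty _ (by omega)]
      simp
  refine ⟨α, fun n => ?_⟩
  induction n using Nat.strong_induction_on with
  | _ n ih =>
    intro hn
    have hnewton := congrArg (MvPolynomial.aeval α) (MvPolynomial.mul_esymm_eq_sum (Fin r) ℂ n)
    simp only [map_mul, map_natCast, map_sum, map_pow, map_neg, map_one] at hnewton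
    have h1 : (n : ℂ) * c n = -∑ k ∈ Finset.Icc 1 n, (∑ i, α i ^ k) * c (n - k) := by
      rw [hesymm n, mul_left_comm, hnewton, ← mul_assoc, pow_succ, ← mul_assoc, ← mul_pow]
      simp only [mul_neg, mul_one, neg_neg, one_pow, neg_mul, one_mul]
      congr 1
      refine Finset.sum_bij' (fun a _ => a.2) (fun k _ => (n - k, k)) ?_ ?_ ?_ ?_ ?_
      · rintro ⟨a, b⟩ h
        simp only [Finset.mem_filter, Finset.HasAntidiagonal.mem_antidiagonal, Finset.mem_Icc] at h ⊢
        omega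
      · intro k h
        simp only [Finset.mem_filter, Finset.HasAntidiagonal.mem_antidiagonal, Finset.mem_Icc] at h ⊢
        omega
      · rintro ⟨a, b⟩ h
        simp only [Finset.mem_filter, Finset.HasAntidiagonal.mem_antidiagonal] at h
        ext <;> simp; omega
      · intro k h; rfl
      · rintro ⟨a, b⟩ h
        simp only [Finset.mem_filter, Finset.HasAntidiagonal.mem_antidiagonal] at h
        have : n - b = a := by omega
        simp only [this]
        rw [hesymm a, MvPolynomial.psum]
        simp only [map_sum, map_pow, MvPolynomial.aeval_X]
        ring
    have hmem : n ∈ Finset.Icc 1 n := Finset.mem_Icc.2 ⟨hn, le_rfl⟩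
    rw [hrec n, ← Finset.sum_erase_add _ _ hmem, ← Finset.sum_erase_add _ _ hmem, neg_add,
      ← Finset.sum_neg_distrib, Nat.sub_self, h0, mul_one, mul_one] at h1
    rw [Finset.sum_congr rfl fun k hk => ?_] at h1
    · exact add_left_cancel h1
    · simp only [Finset.mem_erase, Finset.mem_Icc] at hk
      rw [ih k (by omega) (by omega), neg_mul]

theorem norm_le_of_norm_sum_pow_le {ι : Type*} [Fintype ι] (β : ι → ℂ) {K B : ℝ} (hB : 0 < B)
    {N : ℕ} (h : ∀ n, N ≤ n → ‖∑ i, β i ^ n‖ ≤ K * B ^ n) (i : ι) : ‖β i‖ ≤ B := by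
  classical
  let q : ℂ[X] := ∏ b ∈ (Finset.univ.image β).erase (β i), (X - C b)
  have hq (j : ι) (hj : β j ≠ β i) : q.eval (β j) = 0 := by
    rw [eval_prod]
    exact Finset.prod_eq_zero (i := β j) (by simp [hj]) (by simp)
  have hqi : q.eval (β i) ≠ 0 := by
    rw [eval_prod, Finset.prod_ne_zero_iff]
    intro b hb
    simpa [sub_ne_zero] using (Finset.ne_of_mem_erase hb).symm
  set w : ℕ := (Finset.univ.filter fun j => β j = β i).card with hw
  have hw0 : 0 < w := Finset.card_pos.2 ⟨i, by simp⟩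
  have hident (n : ℕ) : ∑ l ∈ Finset.range (q.natDegree + 1), q.coeff l * ∑ j, β j ^ (n + l) =
      w * (β i ^ n * q.eval (β i)) := by
    have h1 (j : ι) : β j ^ n * q.eval (β j) = if β j = β i then β i ^ n * q.eval (β i) else 0 := by
      split_ifs with hj
      · rw [hj]
      · rw [hq j hj, mul_zero]
    have h2 : ∑ j, β j ^ n * q.eval (β j) = w * (β i ^ n * q.eval (β i)) := by
      rw [Finset.sum_congr rfl fun j _ => h1 j, ← Finset.sum_filter, Finset.sum_const, nsmul_eq_mul]
    rw [← h2]
    simp only [Finset.mul_sum, eval_eq_sum_range]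
    rw [Finset.sum_comm]
    refine Finset.sum_congr rfl fun j _ => Finset.sum_congr rfl fun l _ => ?_
    ring
  set E : ℝ := ∑ l ∈ Finset.range (q.natDegree + 1), ‖q.coeff l‖ * (K * B ^ l) with hE
  have hbound (n : ℕ) (hn : N ≤ n) : (‖β i‖ / B) ^ n ≤ E / ‖q.eval (β i)‖ := by
    rw [div_pow, div_le_div_iff₀ (by positivity) (norm_pos_iff.2 hqi)]
    have h3 : ‖β i ^ n * q.eval (β i)‖ ≤ ‖(w : ℂ) * (β i ^ n * q.eval (β i))‖ := by
      rw [norm_mul (w : ℂ), Complex.norm_natCast]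
      exact le_mul_of_one_le_left (norm_nonneg _) (by exact_mod_cast hw0)
    rw [← norm_pow, ← norm_mul]
    refine h3.trans ?_
    rw [← hident n, hE, Finset.sum_mul]
    refine (norm_sum_le _ _).trans (Finset.sum_le_sum fun l _ => ?_)
    rw [norm_mul, mul_assoc]
    refine mul_le_mul_of_nonneg_left ((h (n + l) (by omega)).trans (le_of_eq ?_)) (norm_nonneg _)
    ring
  by_contra hlt
  push Not at hlt
  have hgt : 1 < ‖β i‖ / B := (one_lt_div hB).2 hlt
  obtain ⟨n, hn⟩ := ((tendsto_pow_atTop_atTop_of_one_lt hgt).eventually_gt_atTop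
    (E / ‖q.eval (β i)‖)).and (Filter.eventually_ge_atTop N) |>.exists
  exact absurd (hbound n hn.2) (not_le.2 hn.1)

/-- The multiplicative function `g ↦ χ (∏ c ∈ s, g(c) ^ e c)` on polynomials. -/
noncomputable def evalChar {p : ℕ} (χ : DirichletCharacter ℂ p) (s : Finset (ZMod p))
    (e : ZMod p → ℕ) : (ZMod p)[X] →* ℂ where
  toFun g := χ (∏ c ∈ s, g.eval c ^ e c)
  map_one' := by simp
  map_mul' g h := by simp [mul_pow, Finset.prod_mul_distrib]

theorem evalChar_apply {p : ℕ} (χ : DirichletCharacter ℂ p) (s : Finset (ZMod p))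
    (e : ZMod p → ℕ) (g : (ZMod p)[X]) : evalChar χ s e g = χ (∏ c ∈ s, g.eval c ^ e c) := rfl

theorem lCoeff_evalChar_eq_zero {p : ℕ} [Fact p.Prime] {χ : DirichletCharacter ℂ p} (hχ : χ ≠ 1)
    {s : Finset (ZMod p)} {e : ZMod p → ℕ} {c₀ : ZMod p} (hc₀ : c₀ ∈ s) (he₀ : e c₀ = 1) {n : ℕ}
    (hn : s.card ≤ n) : lCoeff (evalChar χ s e) n = 0 := by
  classical
  set l : (ZMod p)[X] := ∏ c ∈ s.erase c₀, (X - C c) with hl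
  have hldeg : l.natDegree < n := by
    rw [hl, natDegree_prod_of_monic _ _ fun c _ => monic_X_sub_C c]
    simp only [natDegree_X_sub_C, Finset.sum_const, smul_eq_mul, mul_one,
      Finset.card_erase_of_mem hc₀]
    have := Finset.card_pos.2 ⟨c₀, hc₀⟩
    omega
  have hl0 : l.eval c₀ ≠ 0 := by
    rw [hl, eval_prod, Finset.prod_ne_zero_iff]
    intro c hc
    simpa [sub_ne_zero] using (Finset.ne_of_mem_erase hc).symm
  have hl1 (c) (hc : c ∈ s.erase c₀) : l.eval c = 0 := by
    rw [hl, eval_prod]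
    exact Finset.prod_eq_zero hc (by simp)
  have hmem (t : ZMod p) {g : (ZMod p)[X]} (hg : g ∈ monicsOfDegree p n) :
      g + C t * l ∈ monicsOfDegree p n := by
    rw [mem_monicsOfDegree] at hg ⊢
    have hlt : (C t * l).degree < g.degree := by
      rw [degree_eq_natDegree hg.1.ne_zero, hg.2]
      exact (degree_le_natDegree).trans_lt
        (by exact_mod_cast (natDegree_C_mul_le t l).trans_lt hldeg)
    exact ⟨hg.1.add_of_left hlt, by rw [natDegree_add_eq_left_of_degree_lt hlt, hg.2]⟩
  have hshift (t : ZMod p) : lCoeff (evalChar χ s e) n =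
      ∑ g ∈ monicsOfDegree p n, evalChar χ s e (g + C t * l) := by
    refine (Finset.sum_bij' (fun g _ => g + C t * l) (fun g _ => g + C (-t) * l)
      (fun g hg => hmem t hg) (fun g hg => hmem (-t) hg) ?_ ?_ fun g _ => rfl).symm
    · intro g _; simp
    · intro g _; simp
  have hval (g : (ZMod p)[X]) (t : ZMod p) : evalChar χ s e (g + C t * l) =
      χ (g.eval c₀ + t * l.eval c₀) * χ (∏ c ∈ s.erase c₀, g.eval c ^ e c) := by
    rw [evalChar_apply, ← Finset.mul_prod_erase s _ hc₀, map_mul, he₀, pow_one]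
    congr 2
    · simp
    · refine Finset.prod_congr rfl fun c hc => ?_
      simp [hl1 c hc]
  have hsum (a : ZMod p) : ∑ t, χ (a + t * l.eval c₀) = 0 := by
    rw [← MulChar.sum_eq_zero_of_ne_one hχ]
    exact ((mulRight_bijective₀ _ hl0).comp (Function.bijective_id)).sum_comp
      (fun t => χ (a + t)) |>.trans (Equiv.sum_comp (Equiv.addLeft a) (fun t => χ t))
  have hp : ∑ _t : ZMod p, lCoeff (evalChar χ s e) n = 0 := by
    rw [Finset.sum_congr rfl fun t _ => hshift t, Finset.sum_comm]
    refine Finset.sum_eq_zero fun g _ => ?_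
    simp only [hval]
    rw [← Finset.sum_mul, hsum, zero_mul]
  simpa [ZMod.card, (Fact.out : p.Prime).ne_zero] using hp

theorem lCoeff_one {p : ℕ} [Fact p.Prime] (ψ : (ZMod p)[X] →* ℂ) :
    lCoeff ψ 1 = ∑ x : ZMod p, ψ (X - C x) := by
  rw [lCoeff]
  symm
  refine Finset.sum_bij (fun x _ => X - C x) ?_ ?_ ?_ fun _ _ => rfl
  · intro x _
    exact mem_monicsOfDegree.2 ⟨monic_X_sub_C x, natDegree_X_sub_C x⟩
  · intro x _ y _ h
    simpa using h
  · intro g hg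
    rw [mem_monicsOfDegree] at hg
    refine ⟨-g.coeff 0, Finset.mem_univ _, ?_⟩
    conv_rhs => rw [hg.1.eq_X_add_C hg.2]
    simp

set_option maxHeartbeats 400000 in
theorem norm_extSum_evalChar_le {p : ℕ} [Fact p.Prime] {χ : DirichletCharacter ℂ p} (hχ : χ ≠ 1)
    {s : Finset (ZMod p)} {e : ZMod p → ℕ} {c₀ : ZMod p} (hc₀ : c₀ ∈ s) (he₀ : e c₀ = 1) :
    ∃ (K : ℝ) (N : ℕ), ∀ μ, N ≤ μ → ‖extSum (evalChar χ s e) (2 * μ)‖ ≤ K * (p : ℝ) ^ μ := by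
  classical
  have hp2 : 2 ≤ p := (Fact.out : p.Prime).two_le
  set D := ∑ c ∈ s, e c with hDdef
  refine ⟨(p - 1 : ℕ) * (2 * D + 4 : ℕ) + D, 2 * D + 5, fun μ hμ => ?_⟩
  set P := p ^ μ with hP
  set F := GaloisField p (2 * μ)
  have hμ0 : 2 * μ ≠ 0 := by omega
  have hPD : 2 * D + 5 ≤ P := hμ.trans ((Nat.lt_pow_self hp2).le)
  obtain ⟨M, hM⟩ : p - 1 ∣ P - 1 := by simpa using Nat.sub_dvd_pow_sub_pow p 1 μ
  have hPM : P = (p - 1) * M + 1 := by omega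
  have hcardF : Fintype.card F = P ^ 2 := by
    rw [Fintype.card_eq_nat_card, GaloisField.card p _ hμ0, hP, ← pow_mul, mul_comm]
  have hfr : Module.finrank (ZMod p) F = 2 * μ := GaloisField.finrank p hμ0
  have hinj := (algebraMap (ZMod p) F).injective
  let h : F[X] := ∏ c ∈ s, (C (algebraMap (ZMod p) F c) - X) ^ e c
  let f₁ : F[X] := -∏ c ∈ s.erase c₀, (C (algebraMap (ZMod p) F c) - X) ^ e c
  have hh : h = (X - C (algebraMap (ZMod p) F c₀)) * f₁ := by
    simp only [h, f₁]
    rw [← Finset.mul_prod_erase s _ hc₀, he₀]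
    ring
  have hf₁ : f₁.eval (algebraMap (ZMod p) F c₀) ≠ 0 := by
    simp only [f₁, eval_neg, eval_prod]
    refine neg_ne_zero.2 (Finset.prod_ne_zero_iff.2 fun c hc => ?_)
    rw [eval_pow]
    refine pow_ne_zero _ ?_
    simpa [sub_ne_zero] using hinj.ne (Finset.ne_of_mem_erase hc)
  have hh0 : h ≠ 0 := by
    rw [hh]
    exact mul_ne_zero (X_sub_C_ne_zero _) (fun h => hf₁ (by simp [h]))
  have hdeg : h.natDegree ≤ D := by
    refine (natDegree_prod_le _ _).trans (Finset.sum_le_sum fun c _ => ?_)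
    refine natDegree_pow_le.trans ?_
    have : (C (algebraMap (ZMod p) F c) - X).natDegree ≤ 1 :=
      (natDegree_sub_le _ _).trans (by simp)
    nlinarith
  have hnorm (y : F) : algebraMap (ZMod p) F (Algebra.norm (ZMod p) y) = y ^ (M * (P + 1)) := by
    rw [FiniteField.algebraMap_norm_eq_pow, ← Fintype.card_eq_nat_card (α := F), hcardF,
      Nat.card_zmod]
    congr 1
    refine Nat.div_eq_of_eq_mul_right (by omega) ?_
    have : P ^ 2 - 1 = (P + 1) * (P - 1) := by simpa using Nat.sq_sub_sq P 1
    rw [this, hM]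
    ring
  have hval (x : F) : evalChar χ s e (frobeniusCharpoly x) =
      χ (Algebra.norm (ZMod p) (h.eval x)) := by
    rw [evalChar_apply]
    congr 1
    simp only [h, eval_prod, map_prod, eval_pow, map_pow, eval_sub, eval_C, eval_X,
      norm_algebraMap_sub, frobeniusCharpoly]
    rw [hfr]
  let cnt : ZMod p → ℕ := fun a =>
    (Finset.univ.filter fun x : F => Algebra.norm (ZMod p) (h.eval x) = a).card
  set T := M * P + (2 * D + 4) * P with hT
  have hcnt (a : ZMod p) : cnt a ≤ T := by
    refine le_trans (le_of_eq ?_) (card_pow_eq_le (p := p) hP hcardF hPM hPD (by omega) hh hf₁ hdeg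
      (algebraMap (ZMod p) F a))
    simp only [cnt]
    congr 1
    ext x
    simp [← hnorm, hinj.eq_iff]
  have hcnt0 : cnt 0 ≤ D := by
    refine le_trans (Finset.card_le_card (t := h.roots.toFinset) ?_)
      ((Multiset.toFinset_card_le _).trans ((card_roots' _).trans hdeg))
    intro x hx
    simpa [hh0, Algebra.norm_eq_zero_iff] using hx
  have hcntsum : ∑ a, cnt a = P ^ 2 := by
    rw [← hcardF, ← Finset.card_univ]
    exact (Finset.card_eq_sum_card_fiberwise (fun _ _ => Finset.mem_univ _)).symm
  have hext : extSum (evalChar χ s e) (2 * μ) = ∑ a, χ a * cnt a := by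
    rw [extSum]
    simp only [hval]
    rw [← Finset.sum_fiberwise (s := Finset.univ)
      (g := fun x : F => Algebra.norm (ZMod p) (h.eval x))]
    refine Finset.sum_congr rfl fun a _ => ?_
    rw [Finset.sum_congr rfl (g := fun _ => χ a) fun x hx => by rw [(Finset.mem_filter.1 hx).2]]
    rw [Finset.sum_const, nsmul_eq_mul, mul_comm]
  have hext' : extSum (evalChar χ s e) (2 * μ) =
      -∑ a ∈ Finset.univ.erase 0, χ a * ((T - cnt a : ℝ) : ℂ) := by
    have h1 : ∑ a, χ a * (T : ℂ) = 0 := by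
      rw [← Finset.sum_mul, MulChar.sum_eq_zero_of_ne_one hχ, zero_mul]
    have h2 : ∑ a, χ a * ((T - cnt a : ℝ) : ℂ) =
        ∑ a ∈ Finset.univ.erase 0, χ a * ((T - cnt a : ℝ) : ℂ) := by
      rw [← Finset.add_sum_erase _ _ (Finset.mem_univ (0 : ZMod p)), MulChar.map_zero, zero_mul,
        zero_add]
    rw [← h2, hext]
    push_cast
    simp only [mul_sub, Finset.sum_sub_distrib, h1]
    ring
  rw [hext', norm_neg]
  have h3 : ‖∑ a ∈ Finset.univ.erase 0, χ a * ((T - cnt a : ℝ) : ℂ)‖ ≤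
      ∑ a ∈ Finset.univ.erase (0 : ZMod p), (T - cnt a : ℝ) := by
    refine (norm_sum_le _ _).trans (Finset.sum_le_sum fun a _ => ?_)
    have hnn : (0 : ℝ) ≤ T - cnt a := by
      have := hcnt a
      rw [sub_nonneg]
      exact_mod_cast this
    rw [norm_mul, Complex.norm_real, Real.norm_of_nonneg hnn]
    exact mul_le_of_le_one_left hnn (χ.norm_le_one a)
  refine h3.trans ?_
  have h4 : ∑ a ∈ Finset.univ.erase (0 : ZMod p), (cnt a : ℝ) = P ^ 2 - cnt 0 := by
    rw [Finset.sum_erase_eq_sub (Finset.mem_univ _)]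
    exact_mod_cast congrArg (fun n : ℕ => (n : ℝ) - cnt 0) hcntsum
  rw [Finset.sum_sub_distrib, h4, Finset.sum_const, Finset.card_erase_of_mem (Finset.mem_univ _),
    Finset.card_univ, ZMod.card, nsmul_eq_mul]
  have h5 : (P : ℝ) = (p - 1 : ℕ) * M + 1 := by exact_mod_cast hPM
  have h6 : (cnt 0 : ℝ) ≤ D := by exact_mod_cast hcnt0
  have h7 : (1 : ℝ) ≤ P := by exact_mod_cast (by omega : 1 ≤ P)
  have h8 : (T : ℝ) = M * P + (2 * D + 4 : ℕ) * P := by rw [hT]; push_cast; ring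
  have h9 : (p : ℝ) ^ μ = P := by rw [hP]; push_cast; rfl
  rw [h8, h9]
  have h10 : ((p - 1 : ℕ) : ℝ) * (M * P) = (P - 1) * P := by rw [h5]; ring
  have h11 : (D : ℝ) ≤ D * P := le_mul_of_one_le_right (Nat.cast_nonneg _) h7
  nlinarith

/-- The Weil bound for multiplicative character sums of polynomials which split over the prime
field and have a simple root. -/
theorem norm_sum_char_prod_le {p : ℕ} [Fact p.Prime] {χ : DirichletCharacter ℂ p} (hχ : χ ≠ 1)
    {s : Finset (ZMod p)} {e : ZMod p → ℕ} {c₀ : ZMod p} (hc₀ : c₀ ∈ s) (he₀ : e c₀ = 1) :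
    ‖∑ x : ZMod p, χ (∏ c ∈ s, (c - x) ^ e c)‖ ≤ (s.card - 1 : ℕ) * √p := by
  have hp0 : (0 : ℝ) < p := by exact_mod_cast (Fact.out : p.Prime).pos
  set ψ := evalChar χ s e with hψ
  have hcard := Finset.card_pos.2 ⟨c₀, hc₀⟩
  obtain ⟨α, hα⟩ := exists_eq_neg_sum_pow (c := lCoeff ψ) (S := extSum ψ) (r := s.card - 1)
    (lCoeff_zero ψ) (fun n hn => lCoeff_evalChar_eq_zero hχ hc₀ he₀ (by omega))
    (natCast_mul_lCoeff ψ)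
  obtain ⟨K, N, hK⟩ := norm_extSum_evalChar_le hχ hc₀ he₀
  have hαp (i) : ‖α i‖ ≤ √p := by
    refine Real.le_sqrt_of_sq_le ?_
    rw [← norm_pow]
    refine norm_le_of_norm_sum_pow_le (fun i => α i ^ 2) hp0 (K := K) (N := N + 1) (fun n hn => ?_) i
    have h1 := hK n (by omega)
    rw [hα _ (by omega), norm_neg] at h1
    simpa only [← pow_mul] using h1
  have h2 : ∑ x : ZMod p, χ (∏ c ∈ s, (c - x) ^ e c) = lCoeff ψ 1 := by
    rw [lCoeff_one]
    simp [hψ, evalChar_apply]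
  have h3 : lCoeff ψ 1 = extSum ψ 1 := by
    have := natCast_mul_lCoeff ψ 1
    simpa [lCoeff_zero] using this
  rw [h2, h3, hα 1 le_rfl, norm_neg]
  refine (norm_sum_le _ _).trans ((Finset.sum_le_sum (g := fun _ => √p) fun i _ => ?_).trans
    (le_of_eq ?_))
  · simpa using hαp i
  · simp

end

/-- The Weil bound for products of values of `η` and its powers at shifts, one shift being isolated
and occurring to the first power. -/
theorem norm_sum_prod_pow_le {p : ℕ} [Fact p.Prime] {η : DirichletCharacter ℂ p} (hη : η ≠ 1)
    {ι : Type*} [Fintype ι] (c : ι → ZMod p) (w : ι → ℕ) {i₀ : ι} (hw : w i₀ = 1)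
    (hc : ∀ i, i ≠ i₀ → c i ≠ c i₀) :
    ‖∑ x : ZMod p, ∏ i, η (x + c i) ^ w i‖ ≤ (Fintype.card ι - 1 : ℕ) * √p := by
  classical
  set s := Finset.univ.image fun i => -c i with hs
  set e : ZMod p → ℕ := fun a => ∑ i with -c i = a, w i with he
  have hmem : -c i₀ ∈ s := Finset.mem_image_of_mem _ (Finset.mem_univ _)
  have he₀ : e (-c i₀) = 1 := by
    have : (Finset.univ.filter fun i => -c i = -c i₀) = {i₀} := by
      ext i
      simp only [neg_inj, Finset.mem_filter, Finset.mem_univ, true_and, Finset.mem_singleton]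
      exact ⟨fun h => by_contra fun hi => hc i hi h, fun h => h ▸ rfl⟩
    simp only [he, this, Finset.sum_singleton, hw]
  have hprod (x : ZMod p) : ∏ i, η (x + c i) ^ w i =
      (∏ i, η (-1) ^ w i) * η (∏ a ∈ s, (a - x) ^ e a) := by
    have h1 : ∏ a ∈ s, (a - x) ^ e a = ∏ i, (-c i - x) ^ w i := by
      rw [← Finset.prod_fiberwise_of_maps_to (s := Finset.univ) (t := s) (g := fun i => -c i)
        (fun i _ => Finset.mem_image_of_mem _ (Finset.mem_univ i))]
      refine Finset.prod_congr rfl fun a _ => ?_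
      rw [he, ← Finset.prod_pow_eq_pow_sum]
      refine Finset.prod_congr rfl fun i hi => ?_
      rw [(Finset.mem_filter.1 hi).2]
    rw [h1, map_prod, ← Finset.prod_mul_distrib]
    refine Finset.prod_congr rfl fun i _ => ?_
    rw [map_pow, ← mul_pow, ← map_mul]
    congr 2
    ring
  simp only [hprod]
  rw [← Finset.mul_sum, norm_mul]
  have h1 : ‖∏ i, η (-1) ^ w i‖ ≤ 1 := by
    rw [norm_prod]
    refine Finset.prod_le_one (fun _ _ => norm_nonneg _) fun i _ => ?_
    rw [norm_pow]
    exact pow_le_one₀ (norm_nonneg _) (η.norm_le_one _)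
  refine (mul_le_of_le_one_left (norm_nonneg _) h1).trans
    ((norm_sum_char_prod_le hη hmem he₀).trans ?_)
  have : s.card ≤ Fintype.card ι := Finset.card_image_le
  gcongr

theorem card_filter_exists_eq_le (S : Finset ℕ) :
    ((Fintype.piFinset fun _ : Fin 6 => S).filter fun f => ∀ i, ∃ j, j ≠ i ∧ f j = f i).card ≤
      729 * S.card ^ 3 := by
  classical
  let F : (Fin 3 → ℕ) × (Fin 6 → Fin 3) → Fin 6 → ℕ := fun q => q.1 ∘ q.2
  have hsub : ((Fintype.piFinset fun _ : Fin 6 => S).filter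
      fun f => ∀ i, ∃ j, j ≠ i ∧ f j = f i) ⊆
      ((Fintype.piFinset fun _ : Fin 3 => S) ×ˢ Finset.univ).image F := by
    intro f hf
    rw [Finset.mem_filter, Fintype.mem_piFinset] at hf
    obtain ⟨hfS, hf⟩ := hf
    have hcard : (Finset.univ.image f).card ≤ 3 := by
      have h1 : ∑ b ∈ Finset.univ.image f, (Finset.univ.filter fun i => f i = b).card = 6 := by
        rw [← Finset.card_eq_sum_card_fiberwise (s := Finset.univ)
          (fun i _ => Finset.mem_image_of_mem f (Finset.mem_univ i))]
        simp
      have h2 : ∑ b ∈ Finset.univ.image f, 2 ≤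
          ∑ b ∈ Finset.univ.image f, (Finset.univ.filter fun i => f i = b).card := by
        refine Finset.sum_le_sum fun b hb => ?_
        obtain ⟨i, -, rfl⟩ := Finset.mem_image.1 hb
        obtain ⟨j, hji, hj⟩ := hf i
        rw [← Finset.card_pair hji]
        refine Finset.card_le_card ?_
        intro k hk
        rcases Finset.mem_insert.1 hk with rfl | hk
        · simp [hj]
        · simp [Finset.mem_singleton.1 hk]
      rw [h1, Finset.sum_const, smul_eq_mul] at h2
      omega
    obtain ⟨k⟩ : Nonempty (Finset.univ.image f ↪ Fin 3) :=
      Function.Embedding.nonempty_of_card_le (by simpa using hcard)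
    have : Nonempty (Finset.univ.image f) :=
      ⟨⟨f 0, Finset.mem_image_of_mem f (Finset.mem_univ _)⟩⟩
    refine Finset.mem_image.2 ⟨(fun t => ((Function.invFun k t : Finset.univ.image f) : ℕ),
      fun i => k ⟨f i, Finset.mem_image_of_mem f (Finset.mem_univ i)⟩), ?_, ?_⟩
    · simp only [Finset.mem_product, Fintype.mem_piFinset, Finset.mem_univ, and_true]
      intro t
      obtain ⟨i, -, hi⟩ := Finset.mem_image.1 (Function.invFun k t).2
      rw [← hi]
      exact hfS i
    · funext i
      simp only [F, Function.comp_apply]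
      rw [Function.leftInverse_invFun k.injective]
  refine (Finset.card_le_card hsub).trans (Finset.card_image_le.trans (le_of_eq ?_))
  simp [Finset.card_product, mul_comm]

/-- The sixth moment of short character sums. -/
theorem sum_norm_sum_char_pow_six_le {p : ℕ} [Fact p.Prime] (hp : p ≠ 2)
    {χ : DirichletCharacter ℂ p} (hχ : χ ≠ 1) {B : ℕ} (hB : B ≤ p) :
    ∑ x : ZMod p, ‖∑ b ∈ Finset.Icc 1 B, χ (x + (b : ℕ))‖ ^ 6 ≤
      729 * (B : ℝ) ^ 3 * p + 5 * (B : ℝ) ^ 6 * √p := by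
  classical
  have hp3 : 3 ≤ p := by
    have := (Fact.out : p.Prime).two_le
    omega
  set S := Finset.Icc 1 B with hS
  let η : Fin 6 → DirichletCharacter ℂ p := ![χ, χ, χ, χ⁻¹, χ⁻¹, χ⁻¹]
  have hη (i) : η i = χ ∨ η i = χ⁻¹ := by fin_cases i <;> simp [η]
  have hconj (a : ZMod p) : χ⁻¹ a = (starRingEnd ℂ) (χ a) := by
    exact (congrArg (fun ψ => ψ a) (MulChar.star_eq_inv χ).symm).trans (MulChar.star_apply χ a)
  have hpow (x : ZMod p) : ((‖∑ b ∈ S, χ (x + (b : ℕ))‖ ^ 6 : ℝ) : ℂ) =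
      ∑ f ∈ Fintype.piFinset fun _ : Fin 6 => S, ∏ i, η i (x + (f i : ℕ)) := by
    rw [← Finset.prod_univ_sum (κ := fun _ => ℕ) (fun _ : Fin 6 => S)
      (fun i b => η i (x + (b : ℕ)))]
    rw [show ‖∑ b ∈ S, χ (x + (b : ℕ))‖ ^ 6 = (‖∑ b ∈ S, χ (x + (b : ℕ))‖ ^ 2) ^ 3 by ring]
    push_cast
    rw [← Complex.mul_conj', map_sum]
    simp only [Fin.prod_univ_six, η, ← hconj]
    simp only [Matrix.cons_val]
    ring
  have hinv (ψ : DirichletCharacter ℂ p) (a : ZMod p) : ψ⁻¹ a = ψ a ^ (p - 2) := by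
    rw [MulChar.inv_apply', ← map_pow]
    congr 1
    by_cases ha : a = 0
    · rw [ha, inv_zero, zero_pow (by omega)]
    · refine inv_eq_of_mul_eq_one_right ?_
      rw [← pow_succ', show p - 2 + 1 = p - 1 by omega, ZMod.pow_card_sub_one_eq_one ha]
  have hbad (f : Fin 6 → ℕ) : ‖∑ x : ZMod p, ∏ i, η i (x + (f i : ℕ))‖ ≤ p := by
    refine (norm_sum_le _ _).trans ((Finset.sum_le_card_nsmul _ _ 1 fun x _ => ?_).trans ?_)
    · rw [norm_prod]
      exact Finset.prod_le_one (fun _ _ => norm_nonneg _) fun i _ => (η i).norm_le_one _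
    · simp [ZMod.card]
  have hgood (f : Fin 6 → ℕ) (hf : f ∈ Fintype.piFinset fun _ : Fin 6 => S)
      (hf' : ¬ ∀ i, ∃ j, j ≠ i ∧ f j = f i) :
      ‖∑ x : ZMod p, ∏ i, η i (x + (f i : ℕ))‖ ≤ 5 * √p := by
    push Not at hf'
    obtain ⟨i₀, hi₀⟩ := hf'
    have hne : η i₀ ≠ 1 := by
      rcases hη i₀ with h | h <;> rw [h]
      · exact hχ
      · exact inv_ne_one.2 hχ
    have h1 (i) (a : ZMod p) : η i a = η i₀ a ^ (if η i = η i₀ then 1 else p - 2) := by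
      split_ifs with h
      · rw [h, pow_one]
      · rw [← hinv]
        congr 1
        rcases hη i with h1 | h1 <;> rcases hη i₀ with h2 | h2 <;> simp_all
    simp only [fun x i => h1 i (x + (f i : ℕ))]
    refine (norm_sum_prod_pow_le (i₀ := i₀) hne (fun i => ((f i : ℕ) : ZMod p)) _ (by simp) ?_).trans ?_
    · intro i hi h
      rw [ZMod.natCast_eq_natCast_iff'] at h
      have hfi := Finset.mem_Icc.1 (Fintype.mem_piFinset.1 hf i)
      have hfi₀ := Finset.mem_Icc.1 (Fintype.mem_piFinset.1 hf i₀)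
      refine hi₀ i hi ?_
      rcases lt_or_eq_of_le (hfi.2.trans hB) with h1 | h1 <;>
      rcases lt_or_eq_of_le (hfi₀.2.trans hB) with h2 | h2
      · rwa [Nat.mod_eq_of_lt h1, Nat.mod_eq_of_lt h2] at h
      · rw [Nat.mod_eq_of_lt h1, h2, Nat.mod_self] at h
        omega
      · rw [Nat.mod_eq_of_lt h2, h1, Nat.mod_self] at h
        omega
      · omega
    · simp
  have hsum : ∑ x : ZMod p, ‖∑ b ∈ S, χ (x + (b : ℕ))‖ ^ 6 ≤
      ∑ f ∈ Fintype.piFinset fun _ : Fin 6 => S,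
        ‖∑ x : ZMod p, ∏ i, η i (x + (f i : ℕ))‖ := by
    refine le_trans (le_of_eq ?_) (norm_sum_le _ _)
    rw [Finset.sum_comm]
    simp only [← hpow]
    rw [← Complex.ofReal_sum, Complex.norm_real, Real.norm_of_nonneg]
    positivity
  refine hsum.trans ?_
  rw [← Finset.sum_filter_add_sum_filter_not _ fun f : Fin 6 → ℕ => ∀ i, ∃ j, j ≠ i ∧ f j = f i]
  have hcS : S.card = B := by simp [hS]
  refine add_le_add ?_ ?_
  · refine (Finset.sum_le_card_nsmul _ _ _ fun f _ => hbad f).trans ?_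
    rw [nsmul_eq_mul]
    have := card_filter_exists_eq_le S
    rw [hcS] at this
    gcongr
    exact_mod_cast this
  · refine (Finset.sum_le_card_nsmul _ _ (5 * √p) fun f hf => hgood f (Finset.mem_filter.1 hf).1
      (Finset.mem_filter.1 hf).2).trans ?_
    have h1 : ((((Fintype.piFinset fun _ : Fin 6 => S).filter
        fun f => ¬ ∀ i, ∃ j, j ≠ i ∧ f j = f i).card : ℕ) : ℝ) ≤ (B : ℝ) ^ 6 := by
      refine (Nat.cast_le.2 (Finset.card_filter_le _ _)).trans ?_
      simp [hcS]
    rw [nsmul_eq_mul]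
    have h2 := mul_le_mul_of_nonneg_right h1 (by positivity : 0 ≤ 5 * √(p : ℝ))
    linarith

theorem card_le_of_forall_modEq {T : Finset ℕ} {M N q : ℕ} (hT : T ⊆ Finset.Ioc M (M + N))
    (h : ∀ m ∈ T, ∀ n ∈ T, m ≡ n [MOD q]) : T.card ≤ N / q + 1 := by
  rw [← Finset.card_range (N / q + 1)]
  refine Finset.card_le_card_of_injOn (fun n => (n - M) / q) ?_ ?_
  · intro n hn
    have := Finset.mem_Ioc.1 (hT hn)
    rw [Finset.mem_coe, Finset.mem_range, Nat.lt_succ_iff]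
    exact Nat.div_le_div_right (by omega)
  · intro m hm n hn hmn
    have hm' := Finset.mem_Ioc.1 (hT hm)
    have hn' := Finset.mem_Ioc.1 (hT hn)
    have h1 : (m - M) % q = (n - M) % q := by
      refine Nat.ModEq.add_right_cancel' M ?_
      rw [Nat.sub_add_cancel hm'.1.le, Nat.sub_add_cancel hn'.1.le]
      exact h m hm n hn
    have h2 := Nat.div_add_mod (m - M) q
    have h3 := Nat.div_add_mod (n - M) q
    simp only at hmn
    rw [hmn, h1, h3] at h2
    omega

theorem card_mul_eq_mul_le {p A M N a b : ℕ} (hAN : 4 * A * N < p) (ha : a ∈ Finset.Ioc A (2 * A))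
    (hb : b ∈ Finset.Ioc A (2 * A)) :
    ((Finset.Ioc M (M + N) ×ˢ Finset.Ioc M (M + N)).filter
      fun q => ((q.1 * b : ℕ) : ZMod p) = ((q.2 * a : ℕ) : ZMod p)).card ≤
      N / (a / a.gcd b) + 1 := by
  rw [Finset.mem_Ioc] at ha hb
  set E := (Finset.Ioc M (M + N) ×ˢ Finset.Ioc M (M + N)).filter
      fun q => ((q.1 * b : ℕ) : ZMod p) = ((q.2 * a : ℕ) : ZMod p) with hE
  have key : ∀ u ∈ E, ∀ v ∈ E, ((u.1 : ℤ) - v.1) * b = ((u.2 : ℤ) - v.2) * a := by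
    intro u hu v hv
    simp only [hE, Finset.mem_filter, Finset.mem_product, Finset.mem_Ioc] at hu hv
    obtain ⟨⟨⟨h1, h2⟩, h3, h4⟩, h5⟩ := hu
    obtain ⟨⟨⟨k1, k2⟩, k3, k4⟩, k5⟩ := hv
    have hd : (p : ℤ) ∣ ((u.1 : ℤ) - v.1) * b - ((u.2 : ℤ) - v.2) * a := by
      rw [← ZMod.intCast_zmod_eq_zero_iff_dvd]
      push_cast at h5 k5 ⊢
      linear_combination h5 - k5
    have hlt : |((u.1 : ℤ) - v.1) * b - ((u.2 : ℤ) - v.2) * a| < p := by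
      have e1 : |(u.1 : ℤ) - v.1| ≤ N := by rw [abs_le]; constructor <;> omega
      have e2 : |(u.2 : ℤ) - v.2| ≤ N := by rw [abs_le]; constructor <;> omega
      have e3 : (b : ℤ) ≤ 2 * A := by omega
      have e4 : (a : ℤ) ≤ 2 * A := by omega
      calc |((u.1 : ℤ) - v.1) * b - ((u.2 : ℤ) - v.2) * a|
          ≤ |((u.1 : ℤ) - v.1) * b| + |((u.2 : ℤ) - v.2) * a| := abs_sub _ _
        _ = |(u.1 : ℤ) - v.1| * b + |(u.2 : ℤ) - v.2| * a := by
            rw [abs_mul, abs_mul, Nat.abs_cast, Nat.abs_cast]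
        _ ≤ N * (2 * A) + N * (2 * A) := by gcongr
        _ < p := by
            have : ((4 * A * N : ℕ) : ℤ) < p := by exact_mod_cast hAN
            push_cast at this
            linarith
    exact sub_eq_zero.1 (Int.eq_zero_of_abs_lt_dvd hd hlt)
  have hinj : Set.InjOn Prod.fst (E : Set (ℕ × ℕ)) := by
    intro u hu v hv huv
    have h := key u hu v hv
    rw [huv, sub_self, zero_mul] at h
    have h0 : (a : ℤ) ≠ 0 := by omega
    have h1 := (mul_eq_zero.1 h.symm).resolve_right h0
    exact Prod.ext huv (by omega)
  rw [← Finset.card_image_of_injOn hinj]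
  refine card_le_of_forall_modEq (M := M) (N := N) ?_ ?_
  · intro n hn
    obtain ⟨u, hu, rfl⟩ := Finset.mem_image.1 hn
    exact (Finset.mem_product.1 (Finset.mem_filter.1 hu).1).1
  · intro m hm n hn
    obtain ⟨u, hu, rfl⟩ := Finset.mem_image.1 hm
    obtain ⟨v, hv, rfl⟩ := Finset.mem_image.1 hn
    have h := key v hv u hu
    have hg : 0 < a.gcd b := Nat.gcd_pos_of_pos_left _ (by omega)
    refine Nat.ModEq.symm (Nat.ModEq.cancel_right_div_gcd (c := b) (by omega) ?_) |>.symm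
    refine (Nat.modEq_iff_dvd.2 ?_)
    push_cast
    exact ⟨(v.2 : ℤ) - u.2, by linarith⟩

theorem sum_gcd_le (A : ℕ) :
    ∑ a ∈ Finset.Ioc A (2 * A), ∑ b ∈ Finset.Ioc A (2 * A), (a.gcd b : ℝ) ≤
      4 * (A : ℝ) ^ 2 * (1 + Real.log ((2 * A : ℕ) : ℝ)) := by
  have h1 (a) (ha : a ∈ Finset.Ioc A (2 * A)) (b) (hb : b ∈ Finset.Ioc A (2 * A)) :
      (a.gcd b : ℝ) ≤ ∑ d ∈ Finset.Icc 1 (2 * A),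
        (d : ℝ) * ((if d ∣ a then 1 else 0) * (if d ∣ b then 1 else 0)) := by
    rw [Finset.mem_Ioc] at ha
    refine le_trans (le_of_eq ?_) (Finset.single_le_sum (f := fun d : ℕ =>
      (d : ℝ) * ((if d ∣ a then 1 else 0) * (if d ∣ b then 1 else 0)))
      (fun d _ => by positivity) (a := a.gcd b) (Finset.mem_Icc.2
        ⟨Nat.gcd_pos_of_pos_left _ (by omega), (Nat.gcd_le_left _ (by omega)).trans ha.2⟩))
    simp [Nat.gcd_dvd_left, Nat.gcd_dvd_right]
  have h2 (d) (hd : d ∈ Finset.Icc 1 (2 * A)) :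
      ∑ a ∈ Finset.Ioc A (2 * A), (if d ∣ a then 1 else 0 : ℝ) ≤ (2 * A : ℕ) / d := by
    have h3 : ∑ a ∈ Finset.Ioc A (2 * A), (if d ∣ a then 1 else 0 : ℝ) ≤
        ∑ a ∈ Finset.Ioc 0 (2 * A), (if d ∣ a then 1 else 0 : ℝ) :=
      Finset.sum_le_sum_of_subset_of_nonneg (Finset.Ioc_subset_Ioc_left (Nat.zero_le _))
        fun _ _ _ => by positivity
    refine h3.trans ?_
    rw [Finset.sum_boole, Nat.Ioc_filter_dvd_card_eq_div]
    exact Nat.cast_div_le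
  calc _ ≤ ∑ a ∈ Finset.Ioc A (2 * A), ∑ b ∈ Finset.Ioc A (2 * A), ∑ d ∈ Finset.Icc 1 (2 * A),
        (d : ℝ) * ((if d ∣ a then 1 else 0) * (if d ∣ b then 1 else 0)) :=
        Finset.sum_le_sum fun a ha => Finset.sum_le_sum fun b hb => h1 a ha b hb
    _ = ∑ d ∈ Finset.Icc 1 (2 * A), (d : ℝ) *
        (∑ a ∈ Finset.Ioc A (2 * A), (if d ∣ a then 1 else 0 : ℝ)) ^ 2 := by
      rw [Finset.sum_congr rfl fun a _ => Finset.sum_comm, Finset.sum_comm]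
      refine Finset.sum_congr rfl fun d _ => ?_
      simp only [← Finset.mul_sum, sq, Finset.sum_mul_sum]
    _ ≤ ∑ d ∈ Finset.Icc 1 (2 * A), (d : ℝ) * ((2 * A : ℕ) / d) ^ 2 := by
      refine Finset.sum_le_sum fun d hd => ?_
      have := h2 d hd
      gcongr
    _ = 4 * (A : ℝ) ^ 2 * ∑ d ∈ Finset.Icc 1 (2 * A), (d : ℝ)⁻¹ := by
      rw [Finset.mul_sum]
      refine Finset.sum_congr rfl fun d hd => ?_
      have : (d : ℝ) ≠ 0 := by
        have := (Finset.mem_Icc.1 hd).1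
        positivity
      push_cast
      field_simp
      ring
    _ ≤ _ := by
      gcongr
      have := harmonic_le_one_add_log (2 * A)
      rw [harmonic_eq_sum_Icc] at this
      push_cast at this ⊢
      exact this

/-- The number of solutions of `n₁ a₂ ≡ n₂ a₁` with `aᵢ ∈ (A, 2A]` and `nᵢ ∈ (M, M + N]`. -/
theorem sum_card_mul_eq_mul_le {p A M N : ℕ} (hAN : 4 * A * N < p) (hA : 0 < A) :
    ∑ a ∈ Finset.Ioc A (2 * A), ∑ b ∈ Finset.Ioc A (2 * A),
      ((((Finset.Ioc M (M + N) ×ˢ Finset.Ioc M (M + N)).filter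
      fun q => ((q.1 * b : ℕ) : ZMod p) = ((q.2 * a : ℕ) : ZMod p)).card : ℕ) : ℝ) ≤
      (A : ℝ) ^ 2 + 4 * A * N * (1 + Real.log ((2 * A : ℕ) : ℝ)) := by
  have hA' : (0 : ℝ) < A := by exact_mod_cast hA
  calc _ ≤ ∑ a ∈ Finset.Ioc A (2 * A), ∑ b ∈ Finset.Ioc A (2 * A),
        (1 + (N : ℝ) / A * (a.gcd b : ℝ)) := by
        refine Finset.sum_le_sum fun a ha => Finset.sum_le_sum fun b hb => ?_
        refine (Nat.cast_le.2 (card_mul_eq_mul_le hAN ha hb)).trans ?_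
        rw [Finset.mem_Ioc] at ha
        have hg : 0 < a.gcd b := Nat.gcd_pos_of_pos_left _ (by omega)
        have hg' : (0 : ℝ) < a.gcd b := by exact_mod_cast hg
        have haA : (A : ℝ) ≤ a := by exact_mod_cast ha.1.le
        push_cast
        rw [add_comm]
        gcongr
        refine Nat.cast_div_le.trans ?_
        rw [Nat.cast_div (Nat.gcd_dvd_left a b) hg'.ne']
        rw [div_div_eq_mul_div, div_mul_eq_mul_div]
        gcongr
    _ = (A : ℝ) ^ 2 + (N : ℝ) / A *
        ∑ a ∈ Finset.Ioc A (2 * A), ∑ b ∈ Finset.Ioc A (2 * A), (a.gcd b : ℝ) := by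
        simp only [Finset.sum_add_distrib, ← Finset.mul_sum, Finset.sum_const, Nat.card_Ioc]
        rw [show 2 * A - A = A by omega]
        simp [sq]
    _ ≤ (A : ℝ) ^ 2 + (N : ℝ) / A * (4 * (A : ℝ) ^ 2 * (1 + Real.log ((2 * A : ℕ) : ℝ))) := by
        gcongr
        exact sum_gcd_le A
    _ = _ := by
        field_simp

/-- Hölder's inequality in the form used in Burgess's method. -/
theorem sum_mul_pow_six_le {ι : Type*} (s : Finset ι) {v W : ι → ℝ} (hv : ∀ i ∈ s, 0 ≤ v i)
    (hW : ∀ i ∈ s, 0 ≤ W i) :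
    (∑ i ∈ s, v i * W i) ^ 6 ≤
      (∑ i ∈ s, v i) ^ 4 * (∑ i ∈ s, v i ^ 2) * ∑ i ∈ s, W i ^ 6 := by
  set S₀ := ∑ i ∈ s, v i
  set S₁ := ∑ i ∈ s, v i * W i
  set S₂ := ∑ i ∈ s, v i * W i ^ 2
  set S₃ := ∑ i ∈ s, v i * W i ^ 3
  have n₀ : 0 ≤ S₀ := Finset.sum_nonneg hv
  have n₁ : 0 ≤ S₁ := Finset.sum_nonneg fun i hi => mul_nonneg (hv i hi) (hW i hi)
  have n₂ : 0 ≤ S₂ := Finset.sum_nonneg fun i hi => mul_nonneg (hv i hi) (pow_nonneg (hW i hi) 2)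
  have n₃ : 0 ≤ S₃ := Finset.sum_nonneg fun i hi => mul_nonneg (hv i hi) (pow_nonneg (hW i hi) 3)
  have h₁ : S₁ ^ 2 ≤ S₀ * S₂ := Finset.sum_sq_le_sum_mul_sum_of_sq_le_mul s hv
    (fun i hi => mul_nonneg (hv i hi) (pow_nonneg (hW i hi) 2)) fun i _ => le_of_eq (by ring)
  have h₂ : S₂ ^ 2 ≤ S₁ * S₃ := Finset.sum_sq_le_sum_mul_sum_of_sq_le_mul s
    (fun i hi => mul_nonneg (hv i hi) (hW i hi))
    (fun i hi => mul_nonneg (hv i hi) (pow_nonneg (hW i hi) 3)) fun i _ => le_of_eq (by ring)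
  have h₃ : S₃ ^ 2 ≤ (∑ i ∈ s, v i ^ 2) * ∑ i ∈ s, W i ^ 6 := by
    refine (Finset.sum_mul_sq_le_sq_mul_sq s v fun i => W i ^ 3).trans (le_of_eq ?_)
    simp only [← pow_mul]
  have h₄ : S₁ ^ 3 ≤ S₀ ^ 2 * S₃ := by
    rcases n₁.eq_or_lt with h | h
    · rw [← h, zero_pow three_ne_zero]
      positivity
    · have h5 : S₁ * S₁ ^ 3 ≤ S₁ * (S₀ ^ 2 * S₃) := by
        calc S₁ * S₁ ^ 3 = (S₁ ^ 2) ^ 2 := by ring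
          _ ≤ (S₀ * S₂) ^ 2 := by gcongr
          _ = S₀ ^ 2 * S₂ ^ 2 := by ring
          _ ≤ S₀ ^ 2 * (S₁ * S₃) := by gcongr
          _ = S₁ * (S₀ ^ 2 * S₃) := by ring
      exact le_of_mul_le_mul_left h5 h
  calc S₁ ^ 6 = (S₁ ^ 3) ^ 2 := by ring
    _ ≤ (S₀ ^ 2 * S₃) ^ 2 := by gcongr
    _ = S₀ ^ 4 * S₃ ^ 2 := by ring
    _ ≤ S₀ ^ 4 * ((∑ i ∈ s, v i ^ 2) * ∑ i ∈ s, W i ^ 6) := by gcongr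
    _ = _ := by ring

/-- The number of pairs `(a, n)` in a box with `n / a = y` in `ZMod p`. -/
noncomputable def ratioCount (p A M N : ℕ) (y : ZMod p) : ℕ :=
  ((Finset.Ioc A (2 * A) ×ˢ Finset.Ioc M (M + N)).filter
    fun q => (q.2 : ZMod p) * (q.1 : ZMod p)⁻¹ = y).card

theorem sum_ratioCount_mul {p : ℕ} [Fact p.Prime] (A M N : ℕ) (W : ZMod p → ℝ) :
    ∑ y, (ratioCount p A M N y : ℝ) * W y = ∑ a ∈ Finset.Ioc A (2 * A),
      ∑ n ∈ Finset.Ioc M (M + N), W ((n : ZMod p) * (a : ZMod p)⁻¹) := by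
  rw [← Finset.sum_product', ← Finset.sum_fiberwise (s := Finset.Ioc A (2 * A) ×ˢ _)
    (g := fun q : ℕ × ℕ => (q.2 : ZMod p) * (q.1 : ZMod p)⁻¹)]
  refine Finset.sum_congr rfl fun y _ => ?_
  rw [Finset.sum_congr rfl (g := fun _ => W y)
    fun q hq => by rw [← (Finset.mem_filter.1 hq).2], Finset.sum_const, nsmul_eq_mul]
  rfl

theorem sum_ratioCount {p : ℕ} [Fact p.Prime] (A M N : ℕ) :
    ∑ y, (ratioCount p A M N y : ℝ) = A * N := by
  have := sum_ratioCount_mul (p := p) A M N fun _ => 1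
  simp only [mul_one] at this
  rw [this]
  simp [two_mul]

theorem natCast_ne_zero_of_mem_Ioc {p A a : ℕ} (hp : 2 * A < p)
    (ha : a ∈ Finset.Ioc A (2 * A)) : (a : ZMod p) ≠ 0 := by
  rw [Finset.mem_Ioc] at ha
  rw [Ne, ZMod.natCast_eq_zero_iff]
  exact fun h => absurd (Nat.le_of_dvd (by omega) h) (by omega)

theorem sum_ratioCount_sq {p : ℕ} [Fact p.Prime] {A : ℕ} (hp : 2 * A < p) (M N : ℕ) :
    ∑ y : ZMod p, (ratioCount p A M N y : ℝ) ^ 2 =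
      ∑ a ∈ Finset.Ioc A (2 * A), ∑ b ∈ Finset.Ioc A (2 * A),
      ((((Finset.Ioc M (M + N) ×ˢ Finset.Ioc M (M + N)).filter
      fun q => ((q.1 * b : ℕ) : ZMod p) = ((q.2 * a : ℕ) : ZMod p)).card : ℕ) : ℝ) := by
  simp only [sq]
  rw [sum_ratioCount_mul A M N fun y => (ratioCount p A M N y : ℝ)]
  refine Finset.sum_congr rfl fun a ha => ?_
  have ha0 := natCast_ne_zero_of_mem_Ioc hp ha
  simp only [ratioCount, Finset.card_filter, Finset.sum_product, Nat.cast_sum]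
  rw [Finset.sum_comm]
  refine Finset.sum_congr rfl fun b hb => ?_
  have hb0 := natCast_ne_zero_of_mem_Ioc hp hb
  refine Finset.sum_congr rfl fun m _ => Finset.sum_congr rfl fun n _ => ?_
  congr 1
  refine if_congr ?_ rfl rfl
  rw [← div_eq_mul_inv, ← div_eq_mul_inv, div_eq_div_iff hb0 ha0, Nat.cast_mul, Nat.cast_mul]
  exact eq_comm

theorem sum_ratioCount_sq_le {p : ℕ} [Fact p.Prime] {A M N : ℕ} (hAN : 4 * A * N < p)
    (hA : 0 < A) (hle : A ≤ N) (hp3 : 3 ≤ p) :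
    ∑ y : ZMod p, (ratioCount p A M N y : ℝ) ^ 2 ≤ 9 * A * N * Real.log p := by
  have hp : 2 * A < p := by nlinarith
  have hA' : (0 : ℝ) < A := by exact_mod_cast hA
  have hle' : (A : ℝ) ≤ N := by exact_mod_cast hle
  have hlog : 1 ≤ Real.log p := by
    rw [Real.le_log_iff_exp_le (by positivity)]
    exact Real.exp_one_lt_three.le.trans (by exact_mod_cast hp3)
  have h1 : Real.log ((2 * A : ℕ) : ℝ) ≤ Real.log p :=
    Real.log_le_log (by positivity) (by exact_mod_cast hp.le)
  rw [sum_ratioCount_sq hp]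
  refine (sum_card_mul_eq_mul_le hAN hA).trans ?_
  calc (A : ℝ) ^ 2 + 4 * A * N * (1 + Real.log ((2 * A : ℕ) : ℝ))
      ≤ A * N * Real.log p + 4 * A * N * (Real.log p + Real.log p) := by
        gcongr
        rw [sq]
        calc (A : ℝ) * A ≤ A * N * 1 := by rw [mul_one]; gcongr
          _ ≤ _ := by gcongr
    _ = _ := by ring

theorem sum_norm_sum_char_shift {p : ℕ} [Fact p.Prime] (χ : DirichletCharacter ℂ p) {A : ℕ}
    (hp : 2 * A < p) (M N B : ℕ) :
    ∑ a ∈ Finset.Ioc A (2 * A), ∑ n ∈ Finset.Ioc M (M + N),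
      ‖∑ b ∈ Finset.Icc 1 B, χ ((n + a * b : ℕ) : ZMod p)‖ =
    ∑ y : ZMod p, (ratioCount p A M N y : ℝ) * ‖∑ b ∈ Finset.Icc 1 B, χ (y + (b : ℕ))‖ := by
  rw [sum_ratioCount_mul]
  refine Finset.sum_congr rfl fun a ha => Finset.sum_congr rfl fun n _ => ?_
  have ha0 := natCast_ne_zero_of_mem_Ioc hp ha
  have h1 (b : ℕ) : χ ((n + a * b : ℕ) : ZMod p) =
      χ (a : ZMod p) * χ ((n : ZMod p) * (a : ZMod p)⁻¹ + (b : ℕ)) := by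
    rw [← map_mul]
    congr 1
    push_cast
    field_simp
  simp only [h1]
  rw [← Finset.mul_sum, norm_mul]
  have h2 : ‖χ (a : ZMod p)‖ = 1 := by
    simpa using χ.unit_norm_eq_one (Units.mk0 _ ha0)
  rw [h2, one_mul]

theorem sum_Ioc_shift {p : ℕ} (f : ZMod p → ℂ) (M N h : ℕ) :
    ∑ n ∈ Finset.Ioc M (M + N), f (n : ℕ) = ∑ n ∈ Finset.Ioc M (M + N), f ((n + h : ℕ) : ZMod p) +
      (∑ n ∈ Finset.Ioc M (M + h), f (n : ℕ) -
        ∑ n ∈ Finset.Ioc (M + N) (M + N + h), f (n : ℕ)) := by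
  have h1 : ∑ n ∈ Finset.Ioc M (M + N), f ((n + h : ℕ) : ZMod p) =
      ∑ n ∈ Finset.Ioc (M + h) (M + N + h), f (n : ℕ) := by
    rw [← Finset.map_add_right_Ioc, Finset.sum_map]
    rfl
  have h2 := Finset.sum_Ioc_consecutive (fun n : ℕ => f (n : ℕ)) (Nat.le_add_right M h)
    (by omega : M + h ≤ M + N + h)
  have h3 := Finset.sum_Ioc_consecutive (fun n : ℕ => f (n : ℕ)) (Nat.le_add_right M N)
    (by omega : M + N ≤ M + N + h)
  rw [h1]
  linear_combination h3 - h2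

/-- The amplification step: the average over shifts of short character sums. -/
theorem sum_norm_sum_char_shift_pow_six_le {p : ℕ} [Fact p.Prime] {χ : DirichletCharacter ℂ p}
    (hχ : χ ≠ 1) {A B M N : ℕ} (hAN : 4 * A * N < p) (hA : 0 < A) (hle : A ≤ N) (hp3 : 3 ≤ p)
    (hB : B ^ 6 ≤ p) :
    (∑ a ∈ Finset.Ioc A (2 * A), ∑ n ∈ Finset.Ioc M (M + N),
      ‖∑ b ∈ Finset.Icc 1 B, χ ((n + a * b : ℕ) : ZMod p)‖) ^ 6 ≤
      6606 * (A : ℝ) ^ 5 * (N : ℝ) ^ 5 * (B : ℝ) ^ 3 * p * Real.log p := by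
  have hB3 : (B : ℝ) ^ 3 ≤ √p := by
    refine Real.le_sqrt_of_sq_le ?_
    rw [← pow_mul]
    exact_mod_cast hB
  have hlog : 0 ≤ Real.log p := Real.log_natCast_nonneg p
  have hBp : B ≤ p := (Nat.le_self_pow (by norm_num) B).trans hB
  rw [sum_norm_sum_char_shift χ (by nlinarith)]
  refine (sum_mul_pow_six_le Finset.univ (fun _ _ => Nat.cast_nonneg _)
    fun _ _ => norm_nonneg _).trans ?_
  rw [sum_ratioCount]
  have h1 := sum_norm_sum_char_pow_six_le (by omega) hχ hBp
  have h2 := sum_ratioCount_sq_le (M := M) hAN hA hle hp3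
  have h3 : 5 * (B : ℝ) ^ 6 * √p ≤ 5 * (B : ℝ) ^ 3 * p := by
    calc 5 * (B : ℝ) ^ 6 * √p = 5 * (B : ℝ) ^ 3 * ((B : ℝ) ^ 3 * √p) := by ring
      _ ≤ 5 * (B : ℝ) ^ 3 * (√p * √p) := by gcongr
      _ = _ := by rw [Real.mul_self_sqrt (Nat.cast_nonneg p)]
  calc _ ≤ ((A : ℝ) * N) ^ 4 * (9 * A * N * Real.log p) * (734 * (B : ℝ) ^ 3 * p) := by
        gcongr
        linarith
    _ = _ := by ring

theorem norm_mul_sum_char_le {p : ℕ} (χ : DirichletCharacter ℂ p) {A B M N : ℕ} {E : ℝ}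
    (hE : ∀ M' h : ℕ, h ≤ 2 * A * B → ‖∑ n ∈ Finset.Ioc M' (M' + h), χ (n : ℕ)‖ ≤ E) :
    (A : ℝ) * B * ‖∑ n ∈ Finset.Ioc M (M + N), χ (n : ℕ)‖ ≤
      ∑ a ∈ Finset.Ioc A (2 * A), ∑ n ∈ Finset.Ioc M (M + N),
        ‖∑ b ∈ Finset.Icc 1 B, χ ((n + a * b : ℕ) : ZMod p)‖ + A * B * (2 * E) := by
  set S := ∑ n ∈ Finset.Ioc M (M + N), χ (n : ℕ)
  have hc : (A : ℂ) * B * S = ∑ a ∈ Finset.Ioc A (2 * A), ∑ b ∈ Finset.Icc 1 B, S := by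
    simp [two_mul, mul_assoc]
  have hn : (A : ℝ) * B * ‖S‖ = ‖(A : ℂ) * B * S‖ := by simp
  rw [hn, hc]
  have h1 (a b : ℕ) : S = ∑ n ∈ Finset.Ioc M (M + N), χ ((n + a * b : ℕ) : ZMod p) +
      (∑ n ∈ Finset.Ioc M (M + a * b), χ (n : ℕ) -
        ∑ n ∈ Finset.Ioc (M + N) (M + N + a * b), χ (n : ℕ)) := sum_Ioc_shift (fun x => χ x) M N _
  rw [Finset.sum_congr rfl fun a _ => Finset.sum_congr rfl fun b _ => h1 a b]
  simp only [Finset.sum_add_distrib]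
  refine (norm_add_le _ _).trans (add_le_add ?_ ?_)
  · refine (norm_sum_le _ _).trans (Finset.sum_le_sum fun a _ => ?_)
    rw [Finset.sum_comm]
    exact norm_sum_le _ _
  · have h2 (a) (ha : a ∈ Finset.Ioc A (2 * A)) : ‖∑ b ∈ Finset.Icc 1 B,
        (∑ n ∈ Finset.Ioc M (M + a * b), χ (n : ℕ) -
        ∑ n ∈ Finset.Ioc (M + N) (M + N + a * b), χ (n : ℕ))‖ ≤ B * (2 * E) := by
      refine (norm_sum_le _ _).trans ((Finset.sum_le_card_nsmul _ _ (2 * E) fun b hb => ?_).trans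
        (by simp))
      have hab : a * b ≤ 2 * A * B :=
        Nat.mul_le_mul (Finset.mem_Ioc.1 ha).2 (Finset.mem_Icc.1 hb).2
      refine (norm_sub_le _ _).trans ?_
      have e1 := hE M _ hab
      have e2 := hE (M + N) _ hab
      linarith
    refine (norm_sum_le _ _).trans ((Finset.sum_le_card_nsmul _ _ _ h2).trans (le_of_eq ?_))
    simp [two_mul, mul_assoc]

theorem exists_pow_six_le_lt {n : ℕ} (hn : 0 < n) :
    ∃ B : ℕ, 0 < B ∧ B ^ 6 ≤ n ∧ n < (2 * B) ^ 6 := by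
  have hex : ∃ k : ℕ, n < k ^ 6 := ⟨n + 1, (Nat.lt_succ_self n).trans_le
    (Nat.le_self_pow (by norm_num) _)⟩
  classical
  have h0 : n < Nat.find hex ^ 6 := Nat.find_spec hex
  have h1 : 2 ≤ Nat.find hex := by
    by_contra! h
    have : Nat.find hex ^ 6 ≤ 1 ^ 6 := Nat.pow_le_pow_left (by omega) 6
    omega
  refine ⟨Nat.find hex - 1, by omega, ?_, ?_⟩
  · have := Nat.find_min hex (m := Nat.find hex - 1) (by omega)
    omega
  · exact h0.trans_le (Nat.pow_le_pow_left (by omega) 6)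

theorem four_mul_mul_lt {p A B N : ℕ} (hN : N ^ 12 ≤ p ^ 7) (hp : p < (2 * B) ^ 6)
    (hp0 : 0 < p) (hA : A * (54 * B) ≤ N) : 4 * A * N < p := by
  have h1 : (54 * (4 * A * N)) ^ 6 < (8 * p) ^ 6 := by
    have h2 : (54 * (4 * A * N)) ^ 6 * B ^ 6 < (8 * p) ^ 6 * B ^ 6 := by
      calc (54 * (4 * A * N)) ^ 6 * B ^ 6 = (4 * (A * (54 * B)) * N) ^ 6 := by ring
        _ ≤ (4 * N * N) ^ 6 := by gcongr
        _ = 4 ^ 6 * N ^ 12 := by ring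
        _ ≤ 4 ^ 6 * p ^ 7 := by gcongr
        _ = 4 ^ 6 * p ^ 6 * p := by ring
        _ < 4 ^ 6 * p ^ 6 * (2 * B) ^ 6 := by gcongr
        _ = (8 * p) ^ 6 * B ^ 6 := by ring
    exact lt_of_mul_lt_mul_right h2 (Nat.zero_le _)
  have h3 := lt_of_pow_lt_pow_left₀ 6 (Nat.zero_le _) h1
  omega

/-- Burgess's bound with parameter `r = 3`, in terms of the cube roots `t h` of the lengths. -/
theorem norm_sum_char_le_of_pow {p : ℕ} [Fact p.Prime] (hp3 : 3 ≤ p) {χ : DirichletCharacter ℂ p}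
    (hχ : χ ≠ 1) {t : ℕ → ℝ} (ht0 : ∀ h, 0 ≤ t h) (ht : ∀ h, t h ^ 3 = h) {q l : ℝ} (hq0 : 0 ≤ q)
    (hq : q ^ 9 = p) (hl0 : 0 ≤ l) (hl : l ^ 6 = Real.log p) (N : ℕ) (hN : N ^ 12 ≤ p ^ 7) (M : ℕ) :
    ‖∑ n ∈ Finset.Ioc M (M + N), χ (n : ℕ)‖ ≤ 20 * t N ^ 2 * q * l := by
  induction N using Nat.strong_induction_on generalizing M with | h N ih
  have hlog : 1 ≤ Real.log p := by
    rw [Real.le_log_iff_exp_le (by positivity)]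
    exact Real.exp_one_lt_three.le.trans (by exact_mod_cast hp3)
  have hl1 : 1 ≤ l := (one_le_pow_iff_of_nonneg hl0 (by norm_num : 6 ≠ 0)).1 (hl ▸ hlog)
  have hq1 : 1 ≤ q := (one_le_pow_iff_of_nonneg hq0 (by norm_num : 9 ≠ 0)).1
    (hq ▸ by exact_mod_cast (by omega : 1 ≤ p))
  obtain ⟨B, hB0, hBp, hpB⟩ := exists_pow_six_le_lt (by omega : 0 < p)
  have hB0' : (1 : ℝ) ≤ B := by exact_mod_cast hB0
  have hBq : (B : ℝ) ^ 2 ≤ q ^ 3 := by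
    refine le_of_pow_le_pow_left₀ (by norm_num : 3 ≠ 0) (by positivity) ?_
    rw [← pow_mul, ← pow_mul, hq]
    exact_mod_cast hBp
  have hqB : q ^ 3 ≤ 4 * (B : ℝ) ^ 2 := by
    refine le_of_pow_le_pow_left₀ (by norm_num : 3 ≠ 0) (by positivity) ?_
    rw [← pow_mul, hq]
    calc (p : ℝ) ≤ (2 * B) ^ 6 := by exact_mod_cast hpB.le
      _ = _ := by ring
  have hY : 0 ≤ t N ^ 2 * q * l := by positivity
  rcases lt_or_ge N (54 * B) with hlt | hge
  · have htriv : ‖∑ n ∈ Finset.Ioc M (M + N), χ (n : ℕ)‖ ≤ N := by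
      refine (norm_sum_le _ _).trans
        ((Finset.sum_le_card_nsmul _ _ 1 fun n _ => χ.norm_le_one _).trans ?_)
      simp
    have h1 : t N ≤ 4 * q := by
      refine le_of_pow_le_pow_left₀ (by norm_num : 3 ≠ 0) (by positivity) ?_
      rw [ht]
      have h2 : (N : ℝ) ≤ 54 * B := by exact_mod_cast hlt.le
      have h3 : (B : ℝ) ≤ B ^ 2 := le_self_pow₀ hB0' two_ne_zero
      have h4 : 0 ≤ q ^ 3 := by positivity
      calc (N : ℝ) ≤ 54 * q ^ 3 := by linarith
        _ ≤ 64 * q ^ 3 := by linarith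
        _ = _ := by ring
    refine htriv.trans ?_
    calc (N : ℝ) = t N ^ 2 * t N := by rw [← ht N]; ring
      _ ≤ t N ^ 2 * (4 * q) := by gcongr
      _ = 4 * (t N ^ 2 * q * 1) := by ring
      _ ≤ 4 * (t N ^ 2 * q * l) := by gcongr
      _ ≤ _ := by linarith
  · set A := N / (54 * B) with hA
    have hA0 : 0 < A := Nat.div_pos hge (by omega)
    have hAN : A * (54 * B) ≤ N := Nat.div_mul_le_self _ _
    have hNA : N ≤ 108 * (A * B) := by
      have h1 := Nat.lt_div_mul_add (a := N) (b := 54 * B) (by omega)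
      rw [← hA] at h1
      have h2 : 1 * (54 * B) ≤ A * (54 * B) := Nat.mul_le_mul_right _ hA0
      have h3 : A * (54 * B) = 54 * (A * B) := by ring
      omega
    have hle : A ≤ N := Nat.div_le_self _ _
    have hlt4 : 4 * A * N < p := four_mul_mul_lt hN hpB (by omega) hAN
    have hA0' : (1 : ℝ) ≤ A := by exact_mod_cast hA0
    have hN0 : 0 < N := hA0.trans_le hle
    have hE (M' h : ℕ) (hh : h ≤ 2 * A * B) : ‖∑ n ∈ Finset.Ioc M' (M' + h), χ (n : ℕ)‖ ≤
        20 * (t N / 3) ^ 2 * q * l := by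
      have h27 : 27 * h ≤ N := by
        have h3 : A * (54 * B) = 27 * (2 * A * B) := by ring
        omega
      have hlt : h < N := by omega
      refine (ih h hlt ((Nat.pow_le_pow_left hlt.le 12).trans hN) M').trans ?_
      have h1 : t h ≤ t N / 3 := by
        refine le_of_pow_le_pow_left₀ (by norm_num : 3 ≠ 0) (div_nonneg (ht0 N) (by norm_num)) ?_
        rw [div_pow, ht, ht, le_div_iff₀ (by norm_num)]
        norm_num
        rw [mul_comm]
        exact_mod_cast h27
      have := ht0 h
      gcongr
    have h1 := norm_mul_sum_char_le χ (A := A) (B := B) (M := M) (N := N) hE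
    have h2 := sum_norm_sum_char_shift_pow_six_le (M := M) hχ hlt4 hA0 hle hp3 hBp
    set T := ∑ a ∈ Finset.Ioc A (2 * A), ∑ n ∈ Finset.Ioc M (M + N),
      ‖∑ b ∈ Finset.Icc 1 B, χ ((n + a * b : ℕ) : ZMod p)‖
    have h3 : T ≤ A * B * (12 * (t N ^ 2 * q * l)) := by
      refine le_of_pow_le_pow_left₀ (by norm_num : 6 ≠ 0) (by positivity) (h2.trans ?_)
      have h4 : (N : ℝ) ≤ 108 * (A * B) := by exact_mod_cast hNA
      have hN4 : (N : ℝ) ^ 4 = (t N ^ 2) ^ 6 := by rw [← ht N]; ring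
      rw [← hl, ← hq]
      calc 6606 * (A : ℝ) ^ 5 * N ^ 5 * B ^ 3 * q ^ 9 * l ^ 6
          = 6606 * (A : ℝ) ^ 5 * N ^ 4 * B ^ 3 * q ^ 6 * l ^ 6 * (N * q ^ 3) := by ring
        _ ≤ 6606 * (A : ℝ) ^ 5 * N ^ 4 * B ^ 3 * q ^ 6 * l ^ 6 *
            (108 * (A * B) * (4 * B ^ 2)) := by gcongr
        _ = 2853792 * ((A : ℝ) ^ 6 * B ^ 6 * N ^ 4 * q ^ 6 * l ^ 6) := by ring
        _ ≤ 2985984 * ((A : ℝ) ^ 6 * B ^ 6 * N ^ 4 * q ^ 6 * l ^ 6) := by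
          gcongr
          norm_num
        _ = _ := by rw [hN4]; ring
    have hAB : 0 < (A : ℝ) * B := by positivity
    refine le_of_mul_le_mul_left (h1.trans ?_) hAB
    calc T + A * B * (2 * (20 * (t N / 3) ^ 2 * q * l))
        ≤ A * B * (12 * (t N ^ 2 * q * l)) + A * B * (2 * (20 * (t N / 3) ^ 2 * q * l)) := by
          gcongr
      _ = A * B * ((12 + 40 / 9) * (t N ^ 2 * q * l)) := by ring
      _ ≤ A * B * (20 * (t N ^ 2 * q * l)) := by
        gcongr
        norm_num
      _ = _ := by ring

/-- Burgess's bound with parameter `r = 3`. -/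
theorem norm_sum_char_le_burgess {p : ℕ} [Fact p.Prime] (hp3 : 3 ≤ p)
    {χ : DirichletCharacter ℂ p} (hχ : χ ≠ 1) {N : ℕ} (hN : N ^ 12 ≤ p ^ 7) (M : ℕ) :
    ‖∑ n ∈ Finset.Ioc M (M + N), χ (n : ℕ)‖ ≤
      20 * (N : ℝ) ^ ((2 : ℝ) / 3) * (p : ℝ) ^ ((1 : ℝ) / 9) *
        Real.log p ^ ((1 : ℝ) / 6) := by
  have hroot {y : ℝ} (hy : 0 ≤ y) {k : ℕ} (hk : k ≠ 0) : (y ^ ((1 : ℝ) / k)) ^ k = y := by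
    rw [one_div, Real.rpow_inv_natCast_pow hy hk]
  refine (norm_sum_char_le_of_pow hp3 hχ (t := fun h => (h : ℝ) ^ ((1 : ℝ) / (3 : ℕ)))
    (q := (p : ℝ) ^ ((1 : ℝ) / (9 : ℕ))) (l := Real.log p ^ ((1 : ℝ) / (6 : ℕ)))
    (fun h => by positivity) (fun h => hroot (Nat.cast_nonneg h) three_ne_zero) (by positivity)
    (hroot (Nat.cast_nonneg p) (by norm_num))
    (Real.rpow_nonneg (Real.log_natCast_nonneg p) _)
    (hroot (Real.log_natCast_nonneg p) (by norm_num)) N hN M).trans (le_of_eq ?_)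
  rw [← Real.rpow_natCast, ← Real.rpow_mul (Nat.cast_nonneg N)]
  norm_num

theorem norm_gaussSum_eq {p : ℕ} [Fact p.Prime] {χ : DirichletCharacter ℂ p} (hχ : χ ≠ 1) :
    ‖gaussSum χ (ZMod.stdAddChar (N := p))‖ = √p := by
  have h := gaussSum_mul_gaussSum_eq_card hχ (ZMod.isPrimitive_stdAddChar p)
  rw [← star_gaussSum_eq, ← starRingEnd_apply, Complex.mul_conj', ZMod.card] at h
  rw [eq_comm, Real.sqrt_eq_iff_mul_self_eq (Nat.cast_nonneg p) (norm_nonneg _), ← sq]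
  exact_mod_cast h.symm

theorem gaussSum_mulShift_stdAddChar {p : ℕ} [Fact p.Prime] {χ : DirichletCharacter ℂ p}
    (hχ : χ ≠ 1) (a : ZMod p) : gaussSum χ ((ZMod.stdAddChar (N := p)).mulShift a) =
      χ⁻¹ a * gaussSum χ (ZMod.stdAddChar (N := p)) := by
  by_cases ha : a = 0
  · rw [ha, AddChar.mulShift_zero, gaussSum_one_right hχ, MulChar.map_zero, zero_mul]
  · simpa using gaussSum_mulShift_eq χ (ZMod.stdAddChar (N := p)) (Units.mk0 a ha)

theorem norm_stdAddChar_sub_one_ge {p : ℕ} [NeZero p] {k : ℕ} (hk : 0 < k) (hkp : k < p) :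
    4 ≤ ‖ZMod.stdAddChar (N := p) (k : ZMod p) - 1‖ * (p * ((k : ℝ)⁻¹ + ((p - k : ℕ) : ℝ)⁻¹)) := by
  have hp : (0 : ℝ) < p := by exact_mod_cast hk.trans hkp
  have hk' : (0 : ℝ) < k := by exact_mod_cast hk
  have hpk : (0 : ℝ) < p - k := by
    have : (k : ℝ) < p := by exact_mod_cast hkp
    linarith
  rw [Nat.cast_sub hkp.le]
  set x := Real.pi * k / p with hx
  have hpi := Real.pi_pos
  have hnorm : ‖ZMod.stdAddChar (N := p) (k : ZMod p) - 1‖ = 2 * |Real.sin x| := by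
    have h1 : ZMod.stdAddChar (N := p) (k : ZMod p) =
        Complex.exp (Complex.I * ((2 * x : ℝ) : ℂ)) := by
      have := ZMod.stdAddChar_coe (N := p) k
      rw [Int.cast_natCast] at this
      rw [this]
      congr 1
      rw [hx]
      push_cast
      ring
    rw [h1, Complex.norm_exp_I_mul_ofReal_sub_one, norm_mul, Real.norm_eq_abs, Real.norm_eq_abs,
      mul_div_cancel_left₀ _ two_ne_zero, abs_two]
  have hsin {j : ℝ} (hj : 0 < j) (hjp : j ≤ p / 2) (hjx : Real.sin (Real.pi * j / p) = Real.sin x) :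
      2 ≤ |Real.sin x| * (p * j⁻¹) := by
    have h1 : 2 / Real.pi * (Real.pi * j / p) ≤ Real.sin (Real.pi * j / p) := by
      refine Real.mul_le_sin (by positivity) ?_
      rw [div_le_div_iff₀ hp two_pos]
      nlinarith
    rw [hjx] at h1
    have h2 := h1.trans (le_abs_self _)
    calc 2 = 2 / Real.pi * (Real.pi * j / p) * (p * j⁻¹) := by field_simp
      _ ≤ _ := by gcongr
  rw [hnorm]
  rcases le_total (k : ℝ) (p / 2) with h | h
  · have h1 := hsin hk' h rfl
    have h2 : 0 ≤ |Real.sin x| * (p * ((p : ℝ) - k)⁻¹) := by positivity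
    linarith
  · have h1 := hsin hpk (by linarith) (by
      rw [show Real.pi * ((p : ℝ) - k) / p = Real.pi - x by rw [hx]; field_simp, Real.sin_pi_sub])
    have h2 : 0 ≤ |Real.sin x| * (p * (k : ℝ)⁻¹) := by positivity
    linarith

theorem norm_sum_stdAddChar_le {p : ℕ} [NeZero p] {k : ℕ} (hk : 0 < k) (hkp : k < p) (N : ℕ) :
    ‖∑ n ∈ Finset.range N, ZMod.stdAddChar (N := p) ((k : ZMod p) * (n : ℕ))‖ ≤
      p / 2 * ((k : ℝ)⁻¹ + ((p - k : ℕ) : ℝ)⁻¹) := by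
  set z := ZMod.stdAddChar (N := p) (k : ZMod p) with hz
  have hz1 : ‖z‖ = 1 := by rw [hz, ZMod.stdAddChar_apply, Circle.norm_coe]
  have h1 : ∑ n ∈ Finset.range N, ZMod.stdAddChar (N := p) ((k : ZMod p) * (n : ℕ)) =
      ∑ n ∈ Finset.range N, z ^ n := by
    refine Finset.sum_congr rfl fun n _ => ?_
    rw [hz, ← AddChar.map_nsmul_eq_pow, nsmul_eq_mul, mul_comm]
  have h2 : ‖∑ n ∈ Finset.range N, z ^ n‖ * ‖z - 1‖ ≤ 2 := by
    rw [← norm_mul, geom_sum_mul]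
    refine (norm_sub_le _ _).trans ?_
    rw [norm_pow, hz1, one_pow, norm_one]
    norm_num
  have h3 := norm_stdAddChar_sub_one_ge (p := p) hk hkp
  rw [h1]
  rw [← hz] at h3
  set G := ‖∑ n ∈ Finset.range N, z ^ n‖
  set R := (k : ℝ)⁻¹ + ((p - k : ℕ) : ℝ)⁻¹
  have hR : 0 ≤ p * R := by positivity
  have hG : 0 ≤ G := norm_nonneg _
  have h4 : G * 4 ≤ G * (‖z - 1‖ * (p * R)) := by gcongr
  have h5 : G * ‖z - 1‖ * (p * R) ≤ 2 * (p * R) := by gcongr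
  linarith

/-- The Pólya–Vinogradov inequality for initial segments. -/
theorem norm_sum_char_le_polya_vinogradov {p : ℕ} [Fact p.Prime] (hp3 : 3 ≤ p)
    {χ : DirichletCharacter ℂ p} (hχ : χ ≠ 1) (N : ℕ) :
    ‖∑ n ∈ Finset.range N, χ (n : ℕ)‖ ≤ 2 * √p * Real.log p := by
  have hp0 : (0 : ℝ) < p := by positivity
  have hsq : 0 < √(p : ℝ) := Real.sqrt_pos.2 hp0
  have hχ' : χ⁻¹ ≠ 1 := inv_ne_one.2 hχ
  have hlog : 1 ≤ Real.log p := by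
    rw [Real.le_log_iff_exp_le (by positivity)]
    exact Real.exp_one_lt_three.le.trans (by exact_mod_cast hp3)
  have h1 : (∑ n ∈ Finset.range N, χ (n : ℕ)) * gaussSum χ⁻¹ (ZMod.stdAddChar (N := p)) =
      ∑ a : ZMod p, χ⁻¹ a *
        ∑ n ∈ Finset.range N, ZMod.stdAddChar (N := p) (a * (n : ℕ)) := by
    rw [Finset.sum_mul]
    simp only [Finset.mul_sum]
    rw [Finset.sum_comm]
    refine Finset.sum_congr rfl fun n _ => ?_
    have := gaussSum_mulShift_stdAddChar hχ' ((n : ℕ) : ZMod p)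
    rw [inv_inv] at this
    rw [← this, gaussSum]
    refine Finset.sum_congr rfl fun a _ => ?_
    rw [AddChar.mulShift_apply, mul_comm a]
  have h2 : ‖∑ a : ZMod p, χ⁻¹ a *
        ∑ n ∈ Finset.range N, ZMod.stdAddChar (N := p) (a * (n : ℕ))‖ ≤
      ∑ k ∈ Finset.Ico 1 p, p / 2 * ((k : ℝ)⁻¹ + ((p - k : ℕ) : ℝ)⁻¹) := by
    have h3 : ∑ a : ZMod p, χ⁻¹ a *
        ∑ n ∈ Finset.range N, ZMod.stdAddChar (N := p) (a * (n : ℕ)) =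
        ∑ k ∈ Finset.Ico 1 p, χ⁻¹ ((k : ℕ) : ZMod p) *
        ∑ n ∈ Finset.range N, ZMod.stdAddChar (N := p) ((k : ZMod p) * (n : ℕ)) := by
      rw [← Finset.sum_erase (a := 0) Finset.univ (by rw [MulChar.map_zero, zero_mul])]
      refine Finset.sum_bij' (fun a _ => a.val) (fun k _ => (k : ZMod p)) ?_ ?_ ?_ ?_ ?_
      · intro a ha
        rw [Finset.mem_Ico]
        exact ⟨Nat.pos_of_ne_zero fun h => Finset.ne_of_mem_erase ha ((ZMod.val_eq_zero a).1 h),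
          a.val_lt⟩
      · intro k hk
        rw [Finset.mem_Ico] at hk
        refine Finset.mem_erase.2 ⟨fun h => ?_, Finset.mem_univ _⟩
        rw [ZMod.natCast_eq_zero_iff] at h
        exact absurd (Nat.le_of_dvd (by omega) h) (by omega)
      · intro a _
        simp
      · intro k hk
        exact ZMod.val_cast_of_lt (Finset.mem_Ico.1 hk).2
      · intro a _
        simp
    rw [h3]
    refine (norm_sum_le _ _).trans (Finset.sum_le_sum fun k hk => ?_)
    rw [Finset.mem_Ico] at hk
    rw [norm_mul]
    exact (mul_le_of_le_one_left (norm_nonneg _) (χ⁻¹.norm_le_one _)).trans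
      (norm_sum_stdAddChar_le hk.1 hk.2 N)
  have h4 : ∑ k ∈ Finset.Ico 1 p, (p : ℝ) / 2 * ((k : ℝ)⁻¹ + ((p - k : ℕ) : ℝ)⁻¹) ≤
      p * (1 + Real.log p) := by
    have h5 : ∑ k ∈ Finset.Ico 1 p, ((p - k : ℕ) : ℝ)⁻¹ = ∑ k ∈ Finset.Ico 1 p, (k : ℝ)⁻¹ := by
      refine Finset.sum_bij' (fun k _ => p - k) (fun k _ => p - k) ?_ ?_ ?_ ?_ fun _ _ => rfl
      all_goals
        intro k hk
        simp only [Finset.mem_Ico] at hk ⊢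
        omega
    have h6 : ∑ k ∈ Finset.Ico 1 p, (k : ℝ)⁻¹ ≤ 1 + Real.log p := by
      have := harmonic_le_one_add_log p
      rw [harmonic_eq_sum_Icc] at this
      push_cast at this
      refine le_trans (Finset.sum_le_sum_of_subset_of_nonneg Finset.Ico_subset_Icc_self
        fun _ _ _ => by positivity) this
    rw [← Finset.mul_sum, Finset.sum_add_distrib, h5]
    calc _ ≤ (p : ℝ) / 2 * ((1 + Real.log p) + (1 + Real.log p)) := by gcongr
      _ = _ := by ring
  have h7 := (congrArg norm h1).le.trans (h2.trans h4)
  rw [norm_mul, norm_gaussSum_eq hχ'] at h7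
  refine le_of_mul_le_mul_right (h7.trans ?_) hsq
  calc (p : ℝ) * (1 + Real.log p) ≤ (√p * √p) * (2 * Real.log p) := by
        rw [Real.mul_self_sqrt hp0.le]
        gcongr
        linarith
    _ = _ := by ring

theorem Squarefull.exists_sq_mul_cube {m : ℕ} (h : Squarefull m) (hm : m ≠ 0) :
    ∃ a b : ℕ, Squarefree b ∧ a ^ 2 * b ^ 3 = m := by
  obtain ⟨b, k, rfl, hb⟩ := Nat.sq_mul_squarefree m
  have hb0 : b ≠ 0 := hb.ne_zero
  have hk0 : k ≠ 0 := by
    rintro rfl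
    simp at hm
  have hdvd : b ∣ k := by
    rw [← Nat.factorization_le_iff_dvd hb0 hk0]
    intro q
    have hle := hb.natFactorization_le_one q
    by_contra! hlt
    have hbq : b.factorization q ≠ 0 := by omega
    have hq : q.Prime := by
      by_contra hq
      exact hbq (Nat.factorization_eq_zero_of_not_prime b hq)
    have h2 := h q hq ((Nat.dvd_of_factorization_pos hbq).mul_left _)
    rw [hq.pow_dvd_iff_le_factorization hm, Nat.factorization_mul (pow_ne_zero 2 hk0) hb0,
      Nat.factorization_pow] at h2
    simp only [Finsupp.add_apply, Finsupp.smul_apply, smul_eq_mul] at h2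
    omega
  obtain ⟨a, rfl⟩ := hdvd
  exact ⟨a, b, hb, by ring⟩

theorem squarefull_sq_mul_cube (a b : ℕ) : Squarefull (a ^ 2 * b ^ 3) := by
  intro q hq hdvd
  rcases hq.dvd_mul.1 hdvd with h | h
  · exact (pow_dvd_pow_of_dvd (hq.dvd_of_dvd_pow h) 2).mul_right _
  · exact ((pow_dvd_pow_of_dvd (hq.dvd_of_dvd_pow h) 2).trans
      (pow_dvd_pow b (by norm_num))).mul_left _

theorem Squarefree.dvd_iff_odd_factorization {k b q : ℕ} (hb : Squarefree b) (hk : k ≠ 0)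
    (hq : q.Prime) : q ∣ b ↔ Odd ((k ^ 2 * b).factorization q) := by
  have hle := hb.natFactorization_le_one q
  rw [hq.dvd_iff_one_le_factorization hb.ne_zero,
    Nat.factorization_mul (pow_ne_zero 2 hk) hb.ne_zero, Nat.factorization_pow]
  simp only [Finsupp.add_apply, Finsupp.smul_apply, smul_eq_mul, Nat.odd_iff]
  omega

theorem sq_mul_cube_injective {a b a' b' : ℕ} (hb : Squarefree b) (hb' : Squarefree b')
    (ha : a ≠ 0) (ha' : a' ≠ 0) (h : a ^ 2 * b ^ 3 = a' ^ 2 * b' ^ 3) : a = a' ∧ b = b' := by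
  have hbb : b = b' := by
    refine (Nat.Squarefree.ext_iff hb hb').2 fun q hq => ?_
    rw [hb.dvd_iff_odd_factorization (mul_ne_zero ha hb.ne_zero) hq,
      hb'.dvd_iff_odd_factorization (mul_ne_zero ha' hb'.ne_zero) hq,
      show (a * b) ^ 2 * b = (a' * b') ^ 2 * b' by linarith]
  subst hbb
  have h2 : a ^ 2 = a' ^ 2 :=
    Nat.eq_of_mul_eq_mul_right (pow_pos (Nat.pos_of_ne_zero hb.ne_zero) 3) h
  exact ⟨Nat.pow_left_injective two_ne_zero h2, rfl⟩

open Classical in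
/-- Every square-full number is uniquely of the form `a ^ 2 * b ^ 3` with `b` squarefree. -/
theorem sum_squarefull {M : Type*} [AddCommMonoid M] (f : ℕ → M) (X : ℕ) :
    ∑ m ∈ Finset.Icc 1 X, (if Squarefull m then f m else 0) =
      ∑ b ∈ Finset.Icc 1 X with Squarefree b,
        ∑ a ∈ Finset.Ioc 0 (Nat.sqrt (X / b ^ 3)), f (a ^ 2 * b ^ 3) := by
  rw [← Finset.sum_filter, Finset.sum_sigma']
  have hiff {a b : ℕ} (hb : Squarefree b) : a ≤ Nat.sqrt (X / b ^ 3) ↔ a ^ 2 * b ^ 3 ≤ X := by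
    rw [Nat.le_sqrt', Nat.le_div_iff_mul_le (pow_pos (Nat.pos_of_ne_zero hb.ne_zero) 3)]
  symm
  refine Finset.sum_bij (fun q _ => q.2 ^ 2 * q.1 ^ 3) ?_ ?_ ?_ fun _ _ => rfl
  · rintro ⟨b, a⟩ hq
    simp only [Finset.mem_sigma, Finset.mem_filter, Finset.mem_Ioc] at hq ⊢
    obtain ⟨⟨-, hb⟩, ha0, ha⟩ := hq
    exact ⟨Finset.mem_Icc.2 ⟨mul_pos (pow_pos ha0 2) (pow_pos (Nat.pos_of_ne_zero hb.ne_zero) 3),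
      (hiff hb).1 ha⟩, squarefull_sq_mul_cube a b⟩
  · rintro ⟨b, a⟩ hq ⟨b', a'⟩ hq' h
    simp only [Finset.mem_sigma, Finset.mem_filter, Finset.mem_Ioc] at hq hq'
    obtain ⟨rfl, rfl⟩ := sq_mul_cube_injective hq.1.2 hq'.1.2 hq.2.1.ne' hq'.2.1.ne' h
    rfl
  · intro m hm
    rw [Finset.mem_filter, Finset.mem_Icc] at hm
    obtain ⟨⟨hm0, hmX⟩, hm⟩ := hm
    obtain ⟨a, b, hb, rfl⟩ := hm.exists_sq_mul_cube (by omega)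
    have ha0 : 0 < a := Nat.pos_of_ne_zero (by rintro rfl; simp at hm0)
    have hb0 : 0 < b := Nat.pos_of_ne_zero hb.ne_zero
    refine ⟨⟨b, a⟩, ?_, rfl⟩
    simp only [Finset.mem_sigma, Finset.mem_filter, Finset.mem_Ioc, Finset.mem_Icc]
    refine ⟨⟨⟨hb0, ?_⟩, hb⟩, ha0, (hiff hb).2 hmX⟩
    exact ((Nat.le_self_pow three_ne_zero b).trans
      (Nat.le_mul_of_pos_left _ (pow_pos ha0 2))).trans hmX

theorem norm_sum_squarefull_char_le {p : ℕ} (χ : DirichletCharacter ℂ p) (X : ℕ) :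
    ‖∑ b ∈ Finset.Icc 1 X with Squarefree b,
        ∑ a ∈ Finset.Ioc 0 (Nat.sqrt (X / b ^ 3)), χ ((a ^ 2 * b ^ 3 : ℕ) : ZMod p)‖ ≤
      ∑ b ∈ Finset.Icc 1 X, ‖∑ a ∈ Finset.Ioc 0 (Nat.sqrt (X / b ^ 3)), (χ ^ 2) (a : ℕ)‖ := by
  refine (norm_sum_le _ _).trans ((Finset.sum_le_sum fun b _ => ?_).trans
    (Finset.sum_le_sum_of_subset_of_nonneg (Finset.filter_subset _ _)
      fun _ _ _ => norm_nonneg _))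
  have h (a : ℕ) : χ ((a ^ 2 * b ^ 3 : ℕ) : ZMod p) = (χ ^ 2) (a : ℕ) * χ (b : ℕ) ^ 3 := by
    rw [MulChar.pow_apply' χ two_ne_zero]
    push_cast
    rw [map_mul, map_pow, map_pow]
  simp only [h]
  rw [← Finset.sum_mul, norm_mul, norm_pow]
  exact mul_le_of_le_one_right (norm_nonneg _) (pow_le_one₀ (norm_nonneg _) (χ.norm_le_one _))

theorem cube_root_mul_le {x t : ℝ} (ht : t ^ 3 = x) (ht0 : 0 ≤ t) (hx : 0 ≤ x) {b : ℕ}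
    (hb : 0 < b) {r : ℝ}
    (hr : r ^ 3 ≤ (Nat.sqrt (⌊x⌋₊ / b ^ 3) : ℝ) ^ 2) : r * b ≤ t := by
  refine le_of_pow_le_pow_left₀ three_ne_zero ht0 ?_
  rw [ht, mul_pow]
  have h1 : Nat.sqrt (⌊x⌋₊ / b ^ 3) ^ 2 * b ^ 3 ≤ ⌊x⌋₊ :=
    (Nat.mul_le_mul_right _ (Nat.sqrt_le' _)).trans (Nat.div_mul_le_self _ _)
  calc r ^ 3 * (b : ℝ) ^ 3 ≤ (Nat.sqrt (⌊x⌋₊ / b ^ 3) : ℝ) ^ 2 * (b : ℝ) ^ 3 := by gcongr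
    _ ≤ (⌊x⌋₊ : ℝ) := by exact_mod_cast h1
    _ ≤ x := Nat.floor_le hx

theorem sum_Ioc_zero_eq_sum_range {p : ℕ} [Fact p.Prime] (ψ : DirichletCharacter ℂ p) (N : ℕ) :
    ∑ a ∈ Finset.Ioc 0 N, ψ (a : ℕ) = ∑ a ∈ Finset.range (N + 1), ψ (a : ℕ) := by
  refine Finset.sum_subset (fun a ha => ?_) fun a ha ha' => ?_
  · rw [Finset.mem_Ioc] at ha
    exact Finset.mem_range.2 (by omega)
  · rw [Finset.mem_range] at ha
    rw [Finset.mem_Ioc] at ha'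
    obtain rfl : a = 0 := by omega
    rw [Nat.cast_zero, MulChar.map_zero]

theorem sum_norm_sum_char_sqrt_le {p : ℕ} [Fact p.Prime] (hp3 : 3 ≤ p)
    {ψ : DirichletCharacter ℂ p} (hψ : ψ ≠ 1) {x : ℝ} (hx : 2 ≤ x) :
    ∑ b ∈ Finset.Icc 1 ⌊x⌋₊, ‖∑ a ∈ Finset.Ioc 0 (Nat.sqrt (⌊x⌋₊ / b ^ 3)), ψ (a : ℕ)‖ ≤
      62 * x ^ ((1 : ℝ) / 3) * (p : ℝ) ^ ((1 : ℝ) / 9) * Real.log p ^ ((1 : ℝ) / 6) *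
        Real.log x := by
  have hp1 : (1 : ℝ) ≤ p := by exact_mod_cast (by omega : 1 ≤ p)
  have hlog : 1 ≤ Real.log p := by
    rw [Real.le_log_iff_exp_le (by positivity)]
    exact Real.exp_one_lt_three.le.trans (by exact_mod_cast hp3)
  have hx0 : (0 : ℝ) ≤ x := by linarith
  set t := x ^ ((1 : ℝ) / 3) with ht
  set l := Real.log p ^ ((1 : ℝ) / 6) with hl
  set q := (p : ℝ) ^ ((1 : ℝ) / 18) with hq
  have ht0 : 0 ≤ t := by positivity
  have hl1 : 1 ≤ l := Real.one_le_rpow hlog (by norm_num)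
  have hq0 : 0 < q := by positivity
  have ht3 : t ^ 3 = x := by
    rw [ht, ← Real.rpow_natCast, ← Real.rpow_mul hx0]
    norm_num
  have hq2 : (p : ℝ) ^ ((1 : ℝ) / 9) = q ^ 2 := by
    rw [hq, ← Real.rpow_natCast, ← Real.rpow_mul (by positivity)]
    norm_num
  have hq9 : √(p : ℝ) = q ^ 9 := by
    rw [hq, Real.sqrt_eq_rpow, ← Real.rpow_natCast, ← Real.rpow_mul (by positivity)]
    norm_num
  have hq18 : q ^ 18 = p := by
    rw [hq, ← Real.rpow_natCast, ← Real.rpow_mul (by positivity)]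
    norm_num
  have hlogx : 1 ≤ 2 * Real.log x := by
    have h1 := Real.log_le_log two_pos hx
    have h2 := Real.log_two_gt_d9
    linarith
  set N : ℕ → ℕ := fun b => Nat.sqrt (⌊x⌋₊ / b ^ 3) with hN
  have hsmall (b) (hb : b ∈ (Finset.Icc 1 ⌊x⌋₊).filter fun b => N b ^ 12 ≤ p ^ 7) :
      ‖∑ a ∈ Finset.Ioc 0 (N b), ψ (a : ℕ)‖ ≤ 20 * (t * q ^ 2 * l) * (b : ℝ)⁻¹ := by
    obtain ⟨hb1, hb2⟩ := Finset.mem_filter.1 hb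
    have hb0 := (Finset.mem_Icc.1 hb1).1
    have hb0' : (0 : ℝ) < b := by exact_mod_cast hb0
    have h1 := norm_sum_char_le_burgess hp3 hψ hb2 0
    rw [zero_add, hq2] at h1
    have h2 : (N b : ℝ) ^ ((2 : ℝ) / 3) * b ≤ t := by
      refine cube_root_mul_le ht3 ht0 hx0 hb0 (le_of_eq ?_)
      rw [← Real.rpow_natCast, ← Real.rpow_mul (Nat.cast_nonneg _)]
      norm_num [hN]
    have h3 : (N b : ℝ) ^ ((2 : ℝ) / 3) ≤ t * (b : ℝ)⁻¹ := by
      rwa [← div_eq_mul_inv, le_div_iff₀ hb0']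
    refine h1.trans ?_
    calc 20 * (N b : ℝ) ^ ((2 : ℝ) / 3) * q ^ 2 * l ≤ 20 * (t * (b : ℝ)⁻¹) * q ^ 2 * l := by gcongr
      _ = _ := by ring
  have hlarge (b) (hb : b ∈ (Finset.Icc 1 ⌊x⌋₊).filter fun b => ¬ N b ^ 12 ≤ p ^ 7) :
      q ^ 7 * b ≤ t := by
    obtain ⟨hb1, hb2⟩ := Finset.mem_filter.1 hb
    refine cube_root_mul_le ht3 ht0 hx0 (Finset.mem_Icc.1 hb1).1 ?_
    refine le_of_pow_le_pow_left₀ (by norm_num : 6 ≠ 0) (by positivity) ?_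
    have h1 : (p : ℝ) ^ 7 ≤ (N b : ℝ) ^ 12 := by exact_mod_cast (not_le.1 hb2).le
    calc ((q ^ 7) ^ 3) ^ 6 = (q ^ 18) ^ 7 := by ring
      _ ≤ (N b : ℝ) ^ 12 := by rw [hq18]; exact h1
      _ = _ := by ring
  rw [← Finset.sum_filter_add_sum_filter_not _ fun b => N b ^ 12 ≤ p ^ 7]
  have hY : 0 ≤ t * q ^ 2 * l := by positivity
  have hS : ∑ b ∈ (Finset.Icc 1 ⌊x⌋₊).filter fun b => N b ^ 12 ≤ p ^ 7,
      ‖∑ a ∈ Finset.Ioc 0 (N b), ψ (a : ℕ)‖ ≤ 20 * (t * q ^ 2 * l) * (1 + Real.log x) := by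
    refine (Finset.sum_le_sum hsmall).trans ?_
    rw [← Finset.mul_sum]
    gcongr
    have := harmonic_le_one_add_log ⌊x⌋₊
    rw [harmonic_eq_sum_Icc] at this
    push_cast at this
    refine (Finset.sum_le_sum_of_subset_of_nonneg (Finset.filter_subset _ _)
      fun _ _ _ => by positivity).trans (this.trans ?_)
    gcongr
    · exact_mod_cast Nat.floor_pos.2 (by linarith)
    · exact Nat.floor_le hx0
  have hL : ∑ b ∈ (Finset.Icc 1 ⌊x⌋₊).filter fun b => ¬ N b ^ 12 ≤ p ^ 7,
      ‖∑ a ∈ Finset.Ioc 0 (N b), ψ (a : ℕ)‖ ≤ 2 * (t * q ^ 2 * l) * Real.log x := by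
    set S := (Finset.Icc 1 ⌊x⌋₊).filter fun b => ¬ N b ^ 12 ≤ p ^ 7 with hSdef
    rcases S.eq_empty_or_nonempty with hemp | ⟨b, hb⟩
    · rw [hemp, Finset.sum_empty]
      have : 0 ≤ Real.log x := by linarith
      positivity
    · have hpx : Real.log p ≤ Real.log x := by
        refine Real.log_le_log (by positivity) ?_
        have hb1 : (1 : ℝ) ≤ b := by exact_mod_cast (Finset.mem_Icc.1 (Finset.mem_filter.1 hb).1).1
        have hq1 : 1 ≤ q := Real.one_le_rpow hp1 (by norm_num)
        have h1 : q ^ 7 ≤ t :=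
          (le_mul_of_one_le_right (by positivity) hb1).trans (hlarge b hb)
        calc (p : ℝ) = q ^ 18 := hq18.symm
          _ ≤ q ^ 21 := pow_le_pow_right₀ hq1 (by norm_num)
          _ = (q ^ 7) ^ 3 := by ring
          _ ≤ t ^ 3 := by gcongr
          _ = x := ht3
      have hcard : (S.card : ℝ) * q ^ 7 ≤ t := by
        have hsub : S ⊆ Finset.Icc 1 ⌊t / q ^ 7⌋₊ := by
          intro b hb
          refine Finset.mem_Icc.2 ⟨(Finset.mem_Icc.1 (Finset.mem_filter.1 hb).1).1, ?_⟩
          refine Nat.le_floor ?_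
          rw [le_div_iff₀ (by positivity), mul_comm]
          exact hlarge b hb
        have h1 := Finset.card_le_card hsub
        rw [Nat.card_Icc, Nat.add_sub_cancel] at h1
        rw [← le_div_iff₀ (by positivity)]
        exact (Nat.cast_le.2 h1).trans (Nat.floor_le (by positivity))
      have hpv (b) (_ : b ∈ S) :
          ‖∑ a ∈ Finset.Ioc 0 (N b), ψ (a : ℕ)‖ ≤ 2 * q ^ 9 * Real.log p := by
        rw [sum_Ioc_zero_eq_sum_range, ← hq9]
        exact norm_sum_char_le_polya_vinogradov hp3 hψ _
      refine (Finset.sum_le_card_nsmul _ _ _ hpv).trans ?_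
      rw [nsmul_eq_mul]
      calc (S.card : ℝ) * (2 * q ^ 9 * Real.log p)
          = 2 * (S.card * q ^ 7 * q ^ 2 * 1) * Real.log p := by ring
        _ ≤ 2 * (t * q ^ 2 * l) * Real.log x := by gcongr
  refine (add_le_add hS hL).trans ?_
  rw [hq2]
  calc 20 * (t * q ^ 2 * l) * (1 + Real.log x) + 2 * (t * q ^ 2 * l) * Real.log x
      = (t * q ^ 2 * l) * (20 * 1 + 22 * Real.log x) := by ring
    _ ≤ (t * q ^ 2 * l) * (20 * (2 * Real.log x) + 22 * Real.log x) := by gcongr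
    _ = _ := by ring

open Classical in
/-- Lemma 3: for a Dirichlet character `χ` mod `p` with `χ² ≠ χ₀`, the character sum
over square-full integers up to `x` is `O(x^(1/3) p^(1/9) (log p)^(1/6) (log x))`. -/
theorem squarefull_char_sum_higher_order :
    ∃ C : ℝ, 0 < C ∧ ∀ (p : ℕ) [Fact p.Prime], Odd p →
      ∀ χ : DirichletCharacter ℂ p, χ ^ 2 ≠ 1 →
      ∀ x : ℝ, 2 ≤ x →
        ‖∑ m ∈ Finset.Icc 1 ⌊x⌋₊, if Squarefull m then χ (m : ZMod p) else 0‖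
          ≤ C * x ^ ((1 : ℝ)/3) * (p : ℝ) ^ ((1 : ℝ)/9) * (Real.log p) ^ ((1 : ℝ)/6)
            * Real.log x := by
  refine ⟨62, by norm_num, fun p _ hodd χ hχ x hx => ?_⟩
  have hp3 : 3 ≤ p := by
    have h2 := (Fact.out : p.Prime).two_le
    obtain ⟨k, rfl⟩ := hodd
    omega
  rw [sum_squarefull fun m => χ (m : ZMod p)]
  exact (norm_sum_squarefull_char_le χ _).trans (sum_norm_sum_char_sqrt_le hp3 hχ hx)
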